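/- arXiv:2408.07017 — 6 statements merged into one kernel-verified Lean document; each statement's English description precedes it below -/
import Mathlib

section
/- Let h be a Hessenberg function on {1,…,n} and s = diag(1, 0, …, 0). Then the ideal I_{s,h} of the minimal semisimple matrix Hessenberg scheme satisfies I_{s,h} = ⋂_{i ∈ C(h)} (L_{i−1} + K_{h(i)}), the intersection being over the corner set C(h) of h. -/
open MvPolynomial

noncomputable section

/-- The polynomial ring `R = ℂ[z_{ij} : 1 ≤ i,j ≤ n]` (indices 0-based). -/
abbrev R (n : ℕ) : Type := MvPolynomial (Fin n × Fin n) ℂ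

/-- The ideal `L_i = ⟨z_{11}, …, z_{1i}⟩` (first row, first `i` variables; 0-based columns `j < i`).
    `Lideal n 0 = ⟨0⟩`. -/
def Lideal (n : ℕ) [NeZero n] (i : ℕ) : Ideal (R n) :=
  Ideal.span { p | ∃ j : Fin n, (j : ℕ) < i ∧ p = X ((0 : Fin n), j) }

/-- The ideal `K_j`, generated by the `j × j` minors `p_B = det((z_{kℓ})_{k ∈ B, 1 ≤ ℓ ≤ j})`
    over all `j`-element subsets `B ⊆ {2, …, n}` (0-based: rows `B k ≠ 0`, columns `0,…,j-1`).
    For `j = n` (or `j > n`) there are no such subsets and the ideal is `⟨0⟩`. -/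
def Kideal (n : ℕ) (j : ℕ) : Ideal (R n) :=
  Ideal.span { p | ∃ (hj : j ≤ n) (B : Fin j → Fin n), StrictMono B ∧ (∀ k, (B k : ℕ) ≠ 0) ∧
    p = (Matrix.of fun k l : Fin j => (X (B k, Fin.castLE hj l) : R n)).det }

/-- A Hessenberg function (0-based): `h` is monotone with `h i ≥ i` for all `i`. -/
def IsHessenberg (n : ℕ) (h : Fin n → Fin n) : Prop := Monotone h ∧ ∀ i, i ≤ h i

/-- `i` is a corner of `h`, i.e. (1-based) `h(i) > h(i-1)` with the convention `h(0) = 0`;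
    0-based, `i = 0` is always a corner. -/
def HessCorner (n : ℕ) (h : Fin n → Fin n) (i : Fin n) : Prop :=
  (i : ℕ) = 0 ∨ h ⟨(i : ℕ) - 1, lt_of_le_of_lt (Nat.sub_le _ _) i.isLt⟩ < h i

/-- The `n × (i + h(i))` matrix with columns `x·v_1, …, x·v_i, v_1, …, v_{h(i)}`,
    where `v_j` is the `j`-th column of the generic matrix `Z`. Here (0-based) the paper's
    `i` is `a+1` and the paper's `h(i)` is `(h a) + 1`. -/
def hessMat (n : ℕ) (x : Matrix (Fin n) (Fin n) ℂ) (h : Fin n → Fin n) (a : Fin n) :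
    Matrix (Fin n) (Fin ((a : ℕ) + 1) ⊕ Fin (((h a) : ℕ) + 1)) (R n) :=
  Matrix.of fun r c => Sum.elim
    (fun c' => ∑ k : Fin n, MvPolynomial.C (x r k) * X (k, Fin.castLE a.isLt c'))
    (fun c' => X (r, Fin.castLE (h a).isLt c')) c

/-- The ideal `I_{x,h,i}` generated by all `(h(i)+1) × (h(i)+1)` minors of `hessMat`
    (paper's `h(i)+1` is `(h a) + 2` 0-based). -/
def hessIdealAt (n : ℕ) (x : Matrix (Fin n) (Fin n) ℂ) (h : Fin n → Fin n) (a : Fin n) :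
    Ideal (R n) :=
  Ideal.span { p | ∃ (f : Fin (((h a) : ℕ) + 2) → Fin n)
    (g : Fin (((h a) : ℕ) + 2) → Fin ((a : ℕ) + 1) ⊕ Fin (((h a) : ℕ) + 1)),
    p = ((hessMat n x h a).submatrix f g).det }

/-- The ideal `I_{x,h} = Σ_{i=1}^n I_{x,h,i}`. -/
def hessIdeal (n : ℕ) (x : Matrix (Fin n) (Fin n) ℂ) (h : Fin n → Fin n) : Ideal (R n) :=
  ∑ a : Fin n, hessIdealAt n x h a

/-- The minimal semisimple element `s = diag(1, 0, …, 0)`. -/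
def sMat (n : ℕ) [NeZero n] : Matrix (Fin n) (Fin n) ℂ :=
  Matrix.diagonal (fun i => if i = 0 then 1 else 0)

/-- The rank `r_{pq}(w)` of the top-left `(p+1) × (q+1)` (0-based) submatrix of the
    permutation matrix of `w`. -/
def rankpq (n : ℕ) (w : Equiv.Perm (Fin n)) (p q : Fin n) : ℕ :=
  (Finset.univ.filter fun j : Fin n => j ≤ q ∧ w j ≤ p).card

/-- The Schubert determinantal ideal `I_w`: generated, over all `p, q`, by the minors of size
    `1 + r_{pq}(w)` of the top-left `(p+1) × (q+1)` (0-based) submatrix of the generic matrix. -/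
def schubertIdeal (n : ℕ) (w : Equiv.Perm (Fin n)) : Ideal (R n) :=
  Ideal.span { m | ∃ (p q : Fin n) (f g : Fin (rankpq n w p q + 1) → Fin n),
    (∀ k, f k ≤ p) ∧ (∀ k, g k ≤ q) ∧
    m = (Matrix.of fun k l => (X (f k, g l) : R n)).det }

/-- The generic matrix `Z`. -/
def genZ (n : ℕ) : Matrix (Fin n) (Fin n) (R n) :=
  Matrix.of fun k l => X (k, l)

/-- A telescoping application of the modular law: the intersections of the ideals `L i ⊔ K i`. -/
theorem biInf_sup_le_biSup_mul_sup {A : Type*} [CommRing A] {L K : ℕ → Ideal A}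
    (hL : Monotone L) (hK : Antitone K) (hL0 : L 0 = ⊥)
    (hLK : ∀ i j, L i ⊓ K j ≤ L i * K j) (k : ℕ) :
    (⨅ i ≤ k, L i ⊔ K i) ≤ (⨆ i < k, L (i + 1) * K i) ⊔ K k := by
  induction k with
  | zero => simp [hL0]
  | succ k ih =>
    have hsum : (⨆ i < k, L (i + 1) * K i) ≤ ⨆ i < k + 1, L (i + 1) * K i :=
      iSup₂_le fun i hi => le_iSup₂_of_le i (by lia) le_rfl
    have hsumL : (⨆ i < k, L (i + 1) * K i) ≤ L (k + 1) :=
      iSup₂_le fun i hi => Ideal.mul_le_left.trans (hL (by lia))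
    have hmem : ∀ i ≤ k + 1, (⨅ i ≤ k + 1, L i ⊔ K i) ≤ L i ⊔ K i := fun i hi =>
      iInf₂_le (f := fun i (_ : i ≤ k + 1) => L i ⊔ K i) i hi
    calc (⨅ i ≤ k + 1, L i ⊔ K i)
        ≤ ((⨆ i < k, L (i + 1) * K i) ⊔ K k) ⊓ (L (k + 1) ⊔ K (k + 1)) :=
          le_inf ((le_iInf₂ fun i hi => hmem i (by lia)).trans ih) (hmem _ le_rfl)
      _ = (((⨆ i < k, L (i + 1) * K i) ⊔ K k) ⊓ L (k + 1)) ⊔ K (k + 1) :=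
          (inf_sup_assoc_of_le _ ((hK k.le_succ).trans le_sup_right)).symm
      _ = ((⨆ i < k, L (i + 1) * K i) ⊔ (K k ⊓ L (k + 1))) ⊔ K (k + 1) := by
          rw [sup_inf_assoc_of_le _ hsumL]
      _ ≤ _ := by
          refine sup_le_sup_right (sup_le hsum ?_) _
          rw [inf_comm]
          exact (hLK _ _).trans (le_iSup₂_of_le k k.lt_succ_self le_rfl)

theorem Lideal_mono (n : ℕ) [NeZero n] : Monotone (Lideal n) := by
  intro i j hij
  refine Ideal.span_mono ?_
  rintro p ⟨c, hc, rfl⟩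
  exact ⟨c, hc.trans_le hij, rfl⟩

theorem Lideal_zero (n : ℕ) [NeZero n] : Lideal n 0 = ⊥ := by
  simp [Lideal]

theorem Kideal_antitone (n : ℕ) : Antitone (Kideal n) := by
  refine antitone_nat_of_succ_le fun j => Ideal.span_le.2 ?_
  rintro p ⟨hj, B, hB, hB0, rfl⟩
  rw [SetLike.mem_coe, Matrix.det_succ_column _ (Fin.last j)]
  refine Ideal.sum_mem _ fun r _ => Ideal.mul_mem_left _ _ (Ideal.subset_span ?_)
  refine ⟨by lia, B ∘ r.succAbove, hB.comp r.strictMono_succAbove, fun k => hB0 _, ?_⟩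
  congr 1
  ext k l
  simp [Matrix.submatrix_apply, Fin.succAbove_last]

theorem Kideal_self (n : ℕ) [NeZero n] : Kideal n n = ⊥ := by
  rw [Kideal, Ideal.span_eq_bot]
  rintro p ⟨hj, B, hB, hB0, -⟩
  obtain ⟨k, hk⟩ := (Finite.injective_iff_surjective.1 hB.injective) 0
  exact absurd (by simp [hk]) (hB0 k)

/-- Minors with arbitrary rows avoiding the first one, and arbitrary columns among the first `j`,
lie in `K_j`. -/
theorem det_mem_Kideal {n j : ℕ} [NeZero n] (hj : j ≤ n) (f : Fin j → Fin n) (g : Fin j → Fin j)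
    (hf : ∀ k, f k ≠ 0) :
    (Matrix.of fun k l : Fin j => (X (f k, Fin.castLE hj (g l)) : R n)).det ∈ Kideal n j := by
  by_cases hfi : Function.Injective f
  swap
  · obtain ⟨a, b, hab, hne⟩ := Function.not_injective_iff.1 hfi
    rw [Matrix.det_zero_of_row_eq hne (by ext l; simp [hab])]
    exact zero_mem _
  by_cases hgi : Function.Injective g
  swap
  · obtain ⟨a, b, hab, hne⟩ := Function.not_injective_iff.1 hgi
    rw [Matrix.det_zero_of_column_eq hne (by intro l; simp [hab])]
    exact zero_mem _
  have hmono : StrictMono (f ∘ Tuple.sort f) :=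
    (Tuple.monotone_sort f).strictMono_of_injective (hfi.comp (Tuple.sort f).injective)
  let τ : Equiv.Perm (Fin j) := Equiv.ofBijective g (Finite.injective_iff_bijective.1 hgi)
  let M : Matrix (Fin j) (Fin j) (R n) :=
    Matrix.of fun k l => X ((f ∘ Tuple.sort f) k, Fin.castLE hj l)
  have hM : M.det ∈ Kideal n j :=
    Ideal.subset_span ⟨hj, _, hmono, fun k => Fin.val_ne_zero_iff.2 (hf _), rfl⟩
  have hdet : (Matrix.of fun k l : Fin j => (X (f k, Fin.castLE hj (g l)) : R n)) =
      (M.submatrix (Tuple.sort f).symm id).submatrix id τ := by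
    ext k l
    simp [M, τ]
  rw [hdet, Matrix.det_permute', Matrix.det_permute]
  exact Ideal.mul_mem_left _ _ (Ideal.mul_mem_left _ _ hM)

/-- `L_i` and `K_j` involve disjoint sets of variables. -/
theorem Lideal_inf_Kideal_le (n : ℕ) [NeZero n] (i j : ℕ) :
    Lideal n i ⊓ Kideal n j ≤ Lideal n i * Kideal n j := by
  let φ : R n →ₐ[ℂ] R n := aeval fun p => if p.1 = 0 ∧ (p.2 : ℕ) < i then 0 else X p
  have hφL : Lideal n i ≤ RingHom.ker φ := by
    refine Ideal.span_le.2 ?_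
    rintro p ⟨c, hc, rfl⟩
    simp [φ, hc]
  have hsub : ∀ g, g - φ g ∈ Lideal n i := by
    intro g
    rw [← Ideal.Quotient.eq]
    have : (Ideal.Quotient.mkₐ ℂ (Lideal n i)) = (Ideal.Quotient.mkₐ ℂ (Lideal n i)).comp φ := by
      ext ⟨r, c⟩
      by_cases hp : r = 0 ∧ (c : ℕ) < i
      · obtain ⟨rfl, hc⟩ := hp
        have hX : (X (0, c) : R n) ∈ Lideal n i := Ideal.subset_span ⟨c, hc, rfl⟩
        simpa [φ, hc] using Ideal.Quotient.eq_zero_iff_mem.2 hX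
      · simp [φ, hp]
    exact DFunLike.congr_fun this g
  have hφK : ∀ f ∈ Kideal n j, f - φ f ∈ Lideal n i * Kideal n j := by
    intro f hf
    induction hf using Submodule.span_induction with
    | mem p hp =>
      have hφp : φ p = p := by
        obtain ⟨hj, B, hB, hB0, rfl⟩ := hp
        rw [AlgHom.map_det]
        congr 1
        ext1 k l
        have : B k ≠ 0 := Fin.val_ne_zero_iff.1 (hB0 k)
        simp [φ, this]
      simp [hφp]
    | zero => simp
    | add f g _ _ hf hg =>
      rw [map_add, add_sub_add_comm]
      exact add_mem hf hg
    | smul a f hfK hf =>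
      have : a • f - φ (a • f) = (a - φ a) * f + φ a * (f - φ f) := by
        rw [smul_eq_mul, map_mul]
        ring
      rw [this]
      exact add_mem (Ideal.mul_mem_mul (hsub a) hfK) (Ideal.mul_mem_left _ _ hf)
  rintro f ⟨hfL, hfK⟩
  have hf0 : φ f = 0 := hφL hfL
  simpa [hf0] using hφK f hfK

theorem hessMat_sMat_inl (n : ℕ) [NeZero n] (h : Fin n → Fin n) (a r : Fin n)
    (c : Fin ((a : ℕ) + 1)) :
    hessMat n (sMat n) h a r (Sum.inl c) = if r = 0 then X (0, Fin.castLE a.isLt c) else 0 := by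
  by_cases hr : r = 0 <;> simp [hessMat, sMat, Matrix.diagonal_apply, hr, apply_ite, ite_mul]

theorem hessMat_inr (n : ℕ) (x : Matrix (Fin n) (Fin n) ℂ) (h : Fin n → Fin n) (a r : Fin n)
    (c : Fin ((h a : ℕ) + 1)) :
    hessMat n x h a r (Sum.inr c) = X (r, Fin.castLE (h a).isLt c) := rfl

theorem hessIdealAt_sMat_le (n : ℕ) [NeZero n] (h : Fin n → Fin n) (a : Fin n) :
    hessIdealAt n (sMat n) h a ≤ Lideal n ((a : ℕ) + 1) * Kideal n ((h a : ℕ) + 1) := by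
  refine Ideal.span_le.2 ?_
  rintro p ⟨f, g, rfl⟩
  rw [SetLike.mem_coe]
  by_cases hfi : Function.Injective f
  swap
  · obtain ⟨k, l, hkl, hne⟩ := Function.not_injective_iff.1 hfi
    rw [Matrix.det_zero_of_row_eq hne (by ext c; simp [hkl])]
    exact zero_mem _
  by_cases hgi : Function.Injective g
  swap
  · obtain ⟨k, l, hkl, hne⟩ := Function.not_injective_iff.1 hgi
    rw [Matrix.det_zero_of_column_eq hne (by intro c; simp [hkl])]
    exact zero_mem _
  obtain ⟨c, c', hc⟩ : ∃ c c', g c = Sum.inl c' := by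
    by_contra! hg
    have hr : ∀ c, ∃ d, g c = Sum.inr d := fun c => by
      rcases hgc : g c with d | d
      · exact absurd hgc (hg c d)
      · exact ⟨d, rfl⟩
    choose d hd using hr
    have hdi : Function.Injective d := fun k l hkl => hgi (by rw [hd, hd, hkl])
    simpa using Fintype.card_le_of_injective d hdi
  rw [Matrix.det_succ_column _ c]
  refine Ideal.sum_mem _ fun r _ => ?_
  rw [mul_assoc]
  refine Ideal.mul_mem_left _ _ ?_
  rw [Matrix.submatrix_apply, hc, hessMat_sMat_inl]
  split_ifs with hr
  swap
  · simp
  refine Ideal.mul_mem_mul (Ideal.subset_span ⟨_, c'.isLt, rfl⟩) ?_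
  have hf0 : ∀ k, f (r.succAbove k) ≠ 0 := fun k hk =>
    Fin.succAbove_ne r k (hfi (hk.trans hr.symm))
  by_cases hl : ∃ l d, g (c.succAbove l) = Sum.inl d
  · obtain ⟨l, d, hd⟩ := hl
    rw [Matrix.det_eq_zero_of_column_eq_zero l]
    · exact zero_mem _
    · intro k
      simp [hd, hessMat_sMat_inl, hf0 k]
  · push Not at hl
    have hr : ∀ l, ∃ d, g (c.succAbove l) = Sum.inr d := fun l => by
      rcases hgc : g (c.succAbove l) with d | d
      · exact absurd hgc (hl l d)
      · exact ⟨d, rfl⟩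
    choose d hd using hr
    convert det_mem_Kideal (h a).isLt (fun k => f (r.succAbove k)) d hf0 using 2
    ext1 k l
    simp [hd, hessMat_inr]

theorem mul_le_hessIdealAt_sMat (n : ℕ) [NeZero n] (h : Fin n → Fin n) (a : Fin n) :
    Lideal n ((a : ℕ) + 1) * Kideal n ((h a : ℕ) + 1) ≤ hessIdealAt n (sMat n) h a := by
  rw [Lideal, Kideal, Ideal.span_mul_span', Ideal.span_le]
  rintro _ ⟨_, ⟨c, hc, rfl⟩, _, ⟨hj, B, hB, hB0, rfl⟩, rfl⟩
  refine Ideal.subset_span ⟨Fin.cons 0 B, Fin.cons (Sum.inl ⟨c, hc⟩) Sum.inr, ?_⟩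
  have hB0' : ∀ k, B k ≠ 0 := fun k => Fin.val_ne_zero_iff.1 (hB0 k)
  conv_rhs => rw [Matrix.det_succ_column_zero, Fin.sum_univ_succ]
  simp only [Matrix.submatrix_apply, Fin.cons_zero, Fin.cons_succ, hessMat_sMat_inl, hB0', if_true,
    if_false, mul_zero, zero_mul, Finset.sum_const_zero, add_zero, Fin.val_zero, pow_zero, one_mul]
  congr 1

theorem hessIdeal_sMat (n : ℕ) [NeZero n] (h : Fin n → Fin n) :
    hessIdeal n (sMat n) h = ⨆ a : Fin n, Lideal n ((a : ℕ) + 1) * Kideal n ((h a : ℕ) + 1) := by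
  rw [hessIdeal, Ideal.sum_eq_sup, Finset.sup_univ_eq_iSup]
  exact iSup_congr fun a => (hessIdealAt_sMat_le n h a).antisymm (mul_le_hessIdealAt_sMat n h a)

/-- The intersection over the corners is contained in the components of all indices. -/
theorem iInf_corner_le (n : ℕ) [NeZero n] (h : Fin n → Fin n) (hh : Monotone h) (i : Fin n) :
    (⨅ (i : Fin n) (_ : HessCorner n h i), Lideal n (i : ℕ) ⊔ Kideal n ((h i : ℕ) + 1)) ≤
      Lideal n (i : ℕ) ⊔ Kideal n ((h i : ℕ) + 1) := by
  obtain ⟨i, hi⟩ := i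
  induction i with
  | zero => exact iInf₂_le (⟨0, hi⟩ : Fin n) (Or.inl rfl)
  | succ i ih =>
    by_cases hc : HessCorner n h ⟨i + 1, hi⟩
    · exact iInf₂_le (⟨i + 1, hi⟩ : Fin n) hc
    · have hle : h ⟨i + 1, hi⟩ ≤ h ⟨i, by lia⟩ := not_lt.1 fun hlt => hc (Or.inr hlt)
      have heq : h ⟨i + 1, hi⟩ = h ⟨i, by lia⟩ := hle.antisymm (hh (by simp))
      rw [heq]
      exact (ih (by lia)).trans (sup_le_sup_right (Lideal_mono n i.le_succ) _)

/-- Theorem 4.1, Eq. (4.1), second equality: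
`I_{s,h} = ⋂_{i ∈ C(h)} (L_{i-1} + K_{h(i)})` where `s = diag(1,0,…,0)`.
(0-based: the paper's corner `i` is `i+1`, so `L_{i-1}` is `Lideal n i` and
`K_{h(i)}` is `Kideal n ((h i) + 1)`.) -/
theorem stmt0 (n : ℕ) [NeZero n] (h : Fin n → Fin n) (hh : IsHessenberg n h) :
    hessIdeal n (sMat n) h =
      ⨅ (i : Fin n) (_ : HessCorner n h i),
        (Lideal n (i : ℕ) + Kideal n (((h i) : ℕ) + 1)) := by
  obtain ⟨hmono, hle⟩ := hh
  have hn : 0 < n := Nat.pos_of_ne_zero (NeZero.ne n)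
  rw [hessIdeal_sMat]
  simp only [Submodule.add_eq_sup]
  refine le_antisymm (iSup_le fun a => le_iInf₂ fun i _ => ?_) ?_
  · rcases lt_or_ge a i with hai | hai
    · exact (Ideal.mul_le_left.trans (Lideal_mono n hai)).trans le_sup_left
    · exact (Ideal.mul_le_right.trans
        (Kideal_antitone n (Nat.succ_le_succ (hmono hai)))).trans le_sup_right
  · let H : ℕ → ℕ := fun i => if hi : i < n then (h ⟨i, hi⟩ : ℕ) + 1 else n
    have hH : Monotone H := by
      intro i j hij
      by_cases hj : j < n
      · have hi : i < n := by lia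
        simp only [H, hi, hj, dif_pos]
        exact Nat.succ_le_succ (hmono hij)
      · by_cases hi : i < n
        · simp only [H, hi, hj, dif_pos, dif_neg, not_false_eq_true]
          exact (h ⟨i, hi⟩).isLt
        · simp [H, hi, hj]
    have hlast : H (n - 1) = n := by
      have hi : n - 1 < n := by lia
      have h1 : n - 1 ≤ (h ⟨n - 1, hi⟩ : ℕ) := hle ⟨n - 1, hi⟩
      have h2 := (h ⟨n - 1, hi⟩).isLt
      simp only [H, hi, dif_pos]
      lia
    have key := biInf_sup_le_biSup_mul_sup (K := fun i => Kideal n (H i)) (Lideal_mono n)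
      (fun i j hij => Kideal_antitone n (hH hij)) (Lideal_zero n)
      (fun i j => Lideal_inf_Kideal_le n i (H j)) (n - 1)
    simp only [hlast, Kideal_self, sup_bot_eq] at key
    refine le_trans (le_iInf₂ fun i hi => ?_) (key.trans (iSup₂_le fun i hi => ?_))
    · have hin : i < n := by lia
      simpa only [H, hin, dif_pos] using iInf_corner_le n h hmono ⟨i, hin⟩
    · have hin : i < n := by lia
      refine le_iSup_of_le ⟨i, hin⟩ ?_
      simp only [H, hin, dif_pos, le_refl]
end
end

section
/- Let h be a Hessenberg function on {1,…,n} and s = diag(1, 0, …, 0). The set of minimal primes over the ideal I_{s,h} is exactly {L_{i−1} + K_{h(i)} : i ∈ C(h)}; moreover, for distinct corners i ≠ j in C(h) the primes L_{i−1} + K_{h(i)} and L_{j−1} + K_{h(j)} are distinct and neither contains the other. -/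
open MvPolynomial

noncomputable section

section DeterminantalLocus

attribute [local instance] MvPolynomial.gradedAlgebra

variable {σ : Type*} {m j : ℕ}

/-- The ideal generated by the variables in `T` and by the maximal minors of the matrix of
variables indexed by `e`. -/
def detIdeal (e : Fin m → Fin j → σ) (T : Set σ) : Ideal (MvPolynomial σ ℂ) :=
  Ideal.span (X '' T ∪ { p | ∃ B : Fin j → Fin m, StrictMono B ∧
    p = (Matrix.of fun k l => (X (e (B k) l) : MvPolynomial σ ℂ)).det })

/-- The points at which the coordinates in `T` vanish and the matrix with entries indexed by `e`
has a nontrivial kernel. -/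
def detLocus (e : Fin m → Fin j → σ) (T : Set σ) : Set (σ → ℂ) :=
  { v | (∀ t ∈ T, v t = 0) ∧ ∃ c : Fin j → ℂ, c ≠ 0 ∧ ∀ k, ∑ l, v (e k l) * c l = 0 }

variable {e : Fin m → Fin j → σ} {T : Set σ}

theorem X_mem_detIdeal {t : σ} (ht : t ∈ T) : X t ∈ detIdeal e T :=
  Ideal.subset_span (Or.inl ⟨t, ht, rfl⟩)

theorem det_mem_detIdeal {B : Fin j → Fin m} (hB : StrictMono B) :
    (Matrix.of fun k l => (X (e (B k) l) : MvPolynomial σ ℂ)).det ∈ detIdeal e T :=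
  Ideal.subset_span (Or.inr ⟨B, hB, rfl⟩)

theorem detIdeal_le {I : Ideal (MvPolynomial σ ℂ)} (hT : ∀ t ∈ T, X t ∈ I)
    (hB : ∀ B : Fin j → Fin m, StrictMono B →
      (Matrix.of fun k l => (X (e (B k) l) : MvPolynomial σ ℂ)).det ∈ I) :
    detIdeal e T ≤ I := by
  refine Ideal.span_le.2 ?_
  rintro _ (⟨t, ht, rfl⟩ | ⟨B, h, rfl⟩)
  exacts [hT t ht, hB B h]

theorem eval_det_eq_zero {c : Fin j → ℂ} (hc : c ≠ 0) {w : Fin j → Fin j → σ} {v : σ → ℂ}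
    (h : ∀ k, ∑ l, v (w k l) * c l = 0) :
    eval v (Matrix.of fun k l => (X (w k l) : MvPolynomial σ ℂ)).det = 0 := by
  rw [RingHom.map_det]
  refine Matrix.exists_mulVec_eq_zero_iff.1 ⟨c, hc, funext fun k => ?_⟩
  simpa [Matrix.mulVec, dotProduct] using h k

theorem eval_eq_zero_of_mem_detIdeal {p : MvPolynomial σ ℂ} (hp : p ∈ detIdeal e T) {v : σ → ℂ}
    (hv : v ∈ detLocus e T) : eval v p = 0 := by
  obtain ⟨hT, c, hc, hk⟩ := hv
  have : detIdeal e T ≤ RingHom.ker (eval v) :=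
    detIdeal_le (fun t ht => by simpa using hT t ht)
      fun B _ => eval_det_eq_zero hc fun k => hk (B k)
  exact this hp

theorem isHomogeneous_detIdeal (e : Fin m → Fin j → σ) (T : Set σ) :
    (detIdeal e T).IsHomogeneous (homogeneousSubmodule σ ℂ) := by
  refine Ideal.homogeneous_span _ _ ?_
  rintro _ (⟨t, -, rfl⟩ | ⟨B, -, rfl⟩)
  · exact ⟨1, isHomogeneous_X ℂ t⟩
  · refine ⟨j, ?_⟩
    rw [mem_homogeneousSubmodule, Matrix.det_apply]
    refine IsHomogeneous.sum _ _ _ fun p _ => ?_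
    rw [Units.smul_def, zsmul_eq_mul, ← map_intCast (C : ℂ →+* MvPolynomial σ ℂ)]
    refine IsHomogeneous.C_mul ?_ _
    simpa using IsHomogeneous.prod Finset.univ
      (fun i => (X (e (B (p i)) i) : MvPolynomial σ ℂ)) (fun _ => 1) fun i _ => isHomogeneous_X ℂ _

theorem exists_isHomogeneous_sub_X_mul_mem {I : Ideal (MvPolynomial σ ℂ)}
    (hI : I.IsHomogeneous (homogeneousSubmodule σ ℂ)) {s : σ} {f : MvPolynomial σ ℂ} {d : ℕ}
    (hf : f.IsHomogeneous d) (hmem : f ∈ I ⊔ Ideal.span {X s}) :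
    f ∈ I ∨ ∃ d' < d, ∃ g : MvPolynomial σ ℂ, g.IsHomogeneous d' ∧ f - X s * g ∈ I := by
  classical
  obtain ⟨q, hq, y, hy, rfl⟩ := Submodule.mem_sup.1 hmem
  obtain ⟨g, rfl⟩ := Ideal.mem_span_singleton'.1 hy
  have hqd := homogeneousComponent_mem_of_mem hI hq d
  have hsum : homogeneousComponent d q + homogeneousComponent d (X s * g) = q + g * X s := by
    rw [← map_add, mul_comm, homogeneousComponent_eq_self hf]
  rcases d with _ | d
  · left
    rw [← hsum]
    refine add_mem hqd ?_
    rw [homogeneousComponent_zero, coeff_X_mul']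
    simp
  · right
    have hX : homogeneousComponent (d + 1) (X s * g) = X s * homogeneousComponent d g := by
      ext u
      rw [coeff_homogeneousComponent]
      by_cases hu : s ∈ u.support
      · obtain ⟨u, rfl⟩ : ∃ u', u = Finsupp.single s 1 + u' :=
          ⟨u - Finsupp.single s 1, (add_tsub_cancel_of_le (by
            simpa [Nat.one_le_iff_ne_zero] using hu)).symm⟩
        simp [coeff_X_mul, coeff_homogeneousComponent, add_comm 1]
      · simp [coeff_X_mul', hu]
    refine ⟨d, d.lt_succ_self, homogeneousComponent d g,
      homogeneousComponent_isHomogeneous d g, ?_⟩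
    rwa [← hsum, hX, add_sub_cancel_right]

theorem map_aeval_eq_eval {S : Type*} [CommRing S] [Algebra ℂ S] {φ : S →+* ℂ}
    (hφ : ∀ c, φ (algebraMap ℂ S c) = c) (y : σ → S) (f : MvPolynomial σ ℂ) :
    φ (aeval y f) = eval (fun s => φ (y s)) f := by
  rw [map_aeval, show φ.comp (algebraMap ℂ S) = RingHom.id ℂ from RingHom.ext hφ]
  rfl

/-- If `a(t) g(γ(t))` vanishes identically along a polynomial curve `γ` and `a ≠ 0`, then `g`
vanishes at `γ(0)`. -/
theorem eval_eq_zero_of_curve {g : MvPolynomial σ ℂ} (γ : σ → Polynomial ℂ) {a : Polynomial ℂ}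
    (ha : a ≠ 0) (h : ∀ t, a.eval t * eval (fun s => (γ s).eval t) g = 0) {v : σ → ℂ}
    (hv : ∀ s, (γ s).eval 0 = v s) : eval v g = 0 := by
  have key (t : ℂ) : (aeval γ g).eval t = eval (fun s => (γ s).eval t) g :=
    map_aeval_eq_eval (φ := Polynomial.evalRingHom t) (by simp) γ g
  have h0 : a * aeval γ g = 0 := Polynomial.funext fun t => by simp [key, h t]
  have := key 0
  rw [(mul_eq_zero.1 h0).resolve_left ha] at this
  simpa [hv] using this.symm

theorem mem_of_eval_eq_zero_of_forall_eq_zero {I : Ideal (MvPolynomial σ ℂ)}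
    (hT : ∀ t ∈ T, X t ∈ I) {f : MvPolynomial σ ℂ}
    (hf : ∀ v : σ → ℂ, (∀ t ∈ T, v t = 0) → eval v f = 0) : f ∈ I := by
  classical
  let y : σ → MvPolynomial σ ℂ := fun s => if s ∈ T then 0 else X s
  have h1 : aeval y f = 0 := MvPolynomial.funext fun v => by
    rw [map_aeval_eq_eval (by simp), hf _ fun t ht => by simp [y, ht], map_zero]
  have h2 : (Ideal.Quotient.mkₐ ℂ I).comp (aeval y) = Ideal.Quotient.mkₐ ℂ I := by
    ext s
    by_cases hs : s ∈ T
    · simpa [y, hs] using (Ideal.Quotient.eq_zero_iff_mem.2 (hT s hs)).symm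
    · simp [y, hs]
  have := DFunLike.congr_fun h2 f
  rw [AlgHom.comp_apply, h1, map_zero] at this
  exact Ideal.Quotient.eq_zero_iff_mem.1 this.symm

end DeterminantalLocus

section DeterminantalLocus

variable {σ : Type*} {m j : ℕ}

theorem eval_eq_zero_of_mul_eq_zero_on_detLocus {e : Fin (m + 1) → Fin (j + 1) → σ} {T : Set σ}
    (he : Function.Injective (Function.uncurry e)) {ρ : Fin (j + 1)} (hρ : ρ ≠ 0)
    (hT : ∀ k l, e k l ∈ T → k = 0 ∧ ρ < l) {g : MvPolynomial σ ℂ}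
    (hg : ∀ v ∈ detLocus e T, v (e 0 ρ) * eval v g = 0) {v : σ → ℂ} (hv : v ∈ detLocus e T) :
    eval v g = 0 := by
  obtain ⟨hvT, c, hc, hk⟩ := hv
  have hsum (k p q τ) : ∑ l, (v (e k l) + (if l = ρ then p else 0) + if l = 0 then q else 0) *
      (c l + if l = 0 then τ else 0) = p * c ρ + q * c 0 + (v (e k 0) + q) * τ := by
    have hl (l) : (v (e k l) + (if l = ρ then p else 0) + if l = 0 then q else 0) *
        (c l + if l = 0 then τ else 0) = v (e k l) * c l + (if l = ρ then p * c ρ else 0) +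
          if l = 0 then q * c 0 + (v (e k 0) + q) * τ else 0 := by
      rcases eq_or_ne l 0 with rfl | h0
      · simp only [hρ.symm, if_true, if_false]
        ring
      · rcases eq_or_ne l ρ with rfl | h <;> simp [*, add_mul]
    simp only [hl, Finset.sum_add_distrib, hk, Finset.sum_ite_eq', Finset.mem_univ, if_true]
    ring
  have key (P Q : Fin (m + 1) → Polynomial ℂ) (τ : ℂ → ℂ)
      (hc : ∀ t, (fun l => c l + if l = 0 then τ t else 0) ≠ 0)
      (hk : ∀ t k, (P k).eval t * c ρ + (Q k).eval t * c 0 +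
        (v (e k 0) + (Q k).eval t) * τ t = 0)
      (hP : ∀ k, (P k).eval 0 = 0) (hQ : ∀ k, (Q k).eval 0 = 0)
      (ha : Polynomial.C (v (e 0 ρ)) + P 0 ≠ 0) : eval v g = 0 := by
    let Y (k l) : Polynomial ℂ :=
      Polynomial.C (v (e k l)) + (if l = ρ then P k else 0) + if l = 0 then Q k else 0
    have hY (k l t) : (Y k l).eval t =
        v (e k l) + (if l = ρ then (P k).eval t else 0) + if l = 0 then (Q k).eval t else 0 := by
      simp [Y, apply_ite (Polynomial.eval t)]
    let γ := Function.extend (Function.uncurry e) (Function.uncurry Y)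
      (fun s => Polynomial.C (v s))
    have hγ k l : γ (e k l) = Y k l := he.extend_apply _ _ (k, l)
    have hγ' {s} (hs : ¬ ∃ a, Function.uncurry e a = s) : γ s = Polynomial.C (v s) :=
      Function.extend_apply' _ _ _ hs
    refine eval_eq_zero_of_curve γ (a := Y 0 ρ) (by simpa [Y, hρ] using ha) (fun t => ?_)
      fun s => ?_
    · have := hg (fun s => (γ s).eval t) ⟨fun s hs => ?_, _, hc t, fun k => by
        simpa only [hγ, hY, hsum] using hk t k⟩
      · simpa only [hγ] using this
      · by_cases h : ∃ a, Function.uncurry e a = s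
        · obtain ⟨⟨k, l⟩, rfl⟩ := h
          have hl := (hT k l hs).2
          have hl0 : l ≠ 0 := (lt_of_le_of_lt (Fin.zero_le ρ) hl).ne'
          simpa [hγ, hY, hl.ne', hl0] using hvT _ hs
        · simp [hγ' h, hvT s hs]
    · by_cases h : ∃ a, Function.uncurry e a = s
      · obtain ⟨⟨k, l⟩, rfl⟩ := h
        simp [hγ, hY, hP, hQ]
      · simp [hγ' h]
  by_cases hcase : ∃ a b, a ≠ 0 ∧ a * c ρ + b * c 0 = 0
  · obtain ⟨a, b, ha, hab⟩ := hcase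
    refine key (fun k => if k = 0 then Polynomial.C a * Polynomial.X else 0)
      (fun k => if k = 0 then Polynomial.C b * Polynomial.X else 0) (fun _ => 0) (by simpa using hc)
      (fun t k => ?_) (fun k => by split_ifs <;> simp) (fun k => by split_ifs <;> simp) fun h => ?_
    · split_ifs
      · simp only [Polynomial.eval_mul, Polynomial.eval_C, Polynomial.eval_X]
        linear_combination t * hab
      · simp
    · have := congrArg (fun p => Polynomial.coeff p 1) h
      simp [ha, Polynomial.coeff_C] at this
  · have hc0 : c 0 = 0 := by
      by_contra h
      exact hcase ⟨c 0, -c ρ, h, by ring⟩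
    have hcρ : c ρ ≠ 0 := fun h => hcase ⟨1, 0, one_ne_zero, by simp [h]⟩
    let Q : Fin (m + 1) → Polynomial ℂ := fun k => if k = 0 then Polynomial.X else 0
    have hQ (k) : (Q k).eval 0 = 0 := by
      simp only [Q]
      split_ifs <;> simp
    refine key (fun k => -(Polynomial.C (c ρ)⁻¹ * Polynomial.X * (Polynomial.C (v (e k 0)) + Q k)))
      Q id (fun t h => ?_) (fun t k => ?_) (fun k => by simp) hQ fun h => ?_
    · exact hcρ (by simpa [hρ] using congrFun h ρ)
    · simp only [Polynomial.eval_neg, Polynomial.eval_mul, Polynomial.eval_C, Polynomial.eval_X,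
        Polynomial.eval_add, hc0, id]
      field_simp
      ring
    · have := congrArg (fun p => Polynomial.coeff p 2) h
      simp [Q, hcρ, mul_assoc, Polynomial.coeff_X] at this

theorem X_mul_mem_detIdeal {e : Fin (m + 1) → Fin (j + 1) → σ} {T : Set σ}
    (hT : ∀ l, l ≠ 0 → e 0 l ∈ T) {g : MvPolynomial σ ℂ}
    (hg : g ∈ detIdeal (fun k l => e k.succ l.succ) T) : X (e 0 0) * g ∈ detIdeal e T := by
  suffices detIdeal (fun k l => e k.succ l.succ) T ≤
      Submodule.comap (LinearMap.mulLeft (MvPolynomial σ ℂ) (X (e 0 0))) (detIdeal e T) from this hg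
  refine detIdeal_le (fun t ht => ?_) fun B hB => ?_
  · exact Ideal.mul_mem_left _ _ (X_mem_detIdeal ht)
  · let B' : Fin (j + 1) → Fin (m + 1) := Fin.cons 0 fun k => (B k).succ
    have hB' : StrictMono B' := by
      intro a b hab
      induction b using Fin.cases with
      | zero => exact absurd hab (Fin.not_lt_zero a)
      | succ b =>
        induction a using Fin.cases with
        | zero => exact Fin.succ_pos _
        | succ a => simpa [B'] using hB (Fin.succ_lt_succ_iff.1 hab)
    have h := det_mem_detIdeal (e := e) (T := T) hB'
    rw [Matrix.det_succ_row_zero, Fin.sum_univ_succ] at h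
    have h := (Ideal.add_mem_iff_left _ (Ideal.sum_mem _ fun l _ => ?_)).1 h
    · simpa [B', Matrix.submatrix] using h
    · refine Ideal.mul_mem_right _ _ (Ideal.mul_mem_left _ _ (X_mem_detIdeal ?_))
      exact hT _ (Fin.succ_ne_zero l)

theorem mem_detIdeal_of_isHomogeneous {e : Fin m → Fin j → σ} {T : Set σ}
    (he : Function.Injective (Function.uncurry e)) (hT : ∀ k l, e k l ∉ T)
    {f : MvPolynomial σ ℂ} {d : ℕ} (hd : f.IsHomogeneous d)
    (hf : ∀ v ∈ detLocus e T, eval v f = 0) : f ∈ detIdeal e T := by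
  induction m generalizing j T f d with
  | zero =>
    rcases j with _ | j
    · have := det_mem_detIdeal (e := e) (T := T) (Subsingleton.strictMono Fin.elim0)
      rw [Matrix.det_isEmpty] at this
      exact (Ideal.eq_top_iff_one _).2 this ▸ Submodule.mem_top
    · exact mem_of_eval_eq_zero_of_forall_eq_zero (fun _ => X_mem_detIdeal) fun v hv =>
        hf v ⟨hv, 1, one_ne_zero, fun k => k.elim0⟩
  | succ m ih =>
    rcases j with _ | j
    · have := det_mem_detIdeal (e := e) (T := T) (Subsingleton.strictMono Fin.elim0)
      rw [Matrix.det_isEmpty] at this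
      exact (Ideal.eq_top_iff_one _).2 this ▸ Submodule.mem_top
    let S : ℕ → Set σ := fun r => T ∪ { s | ∃ l : Fin (j + 1), r ≤ l ∧ s = e 0 l }
    have hS (r : ℕ) (k l) : e k l ∈ S r ↔ k = 0 ∧ r ≤ l := by
      constructor
      · rintro (h | ⟨l', hl', h⟩)
        · exact absurd h (hT k l)
        · obtain ⟨rfl, rfl⟩ := Prod.mk.inj (@he (k, l) (0, l') h)
          exact ⟨rfl, hl'⟩
      · rintro ⟨rfl, h⟩
        exact Or.inr ⟨l, h, rfl⟩
    have hSanti (r : ℕ) : S (r + 1) ⊆ S r := by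
      rintro s (h | ⟨l, hl, rfl⟩)
      exacts [Or.inl h, Or.inr ⟨l, (Nat.le_succ r).trans hl, rfl⟩]
    have hstep (r : Fin (j + 1)) :
        detIdeal e (S r) ≤ detIdeal e (S (r + 1)) ⊔ Ideal.span {X (e 0 r)} := by
      refine detIdeal_le ?_ fun B hB => Ideal.mem_sup_left (det_mem_detIdeal hB)
      rintro s (h | ⟨l, hl, rfl⟩)
      · exact Ideal.mem_sup_left (X_mem_detIdeal (Or.inl h))
      · rcases hl.eq_or_lt with h | h
        · exact Ideal.mem_sup_right (Ideal.subset_span (by rw [Fin.ext h]; rfl))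
        · exact Ideal.mem_sup_left (X_mem_detIdeal (Or.inr ⟨l, h, rfl⟩))
    have main (r : ℕ) (hr : r ≤ j + 1) : ∀ (d : ℕ) (f : MvPolynomial σ ℂ), f.IsHomogeneous d →
        (∀ v ∈ detLocus e (S r), eval v f = 0) → f ∈ detIdeal e (S r) := by
      induction r with
      | zero =>
        intro d f hd hf
        have h1 : f ∈ detIdeal (fun k => e k.succ) (S 0) := by
          refine ih (fun a b hab => ?_) (fun k l h => ?_) hd fun v hv => hf v ?_
          · have := Prod.ext_iff.1 (@he (a.1.succ, a.2) (b.1.succ, b.2) hab)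
            exact Prod.ext (Fin.succ_injective _ this.1) this.2
          · exact Fin.succ_ne_zero _ ((hS _ _ _).1 h).1
          · obtain ⟨hvT, c, hc, hk⟩ := hv
            refine ⟨hvT, c, hc, Fin.cases ?_ hk⟩
            exact Finset.sum_eq_zero fun l _ => by
              rw [hvT _ ((hS _ _ _).2 ⟨rfl, Nat.zero_le _⟩), zero_mul]
        refine detIdeal_le (fun t => X_mem_detIdeal) (fun B hB => ?_) h1
        exact det_mem_detIdeal (Fin.strictMono_succ.comp hB)
      | succ r ihr =>
        let ρ : Fin (j + 1) := ⟨r, hr⟩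
        have hvan {d f} (hd : IsHomogeneous f d) (hf : ∀ v ∈ detLocus e (S (r + 1)), eval v f = 0) :
            f ∈ detIdeal e (S (r + 1)) ∨ ∃ d' < d, ∃ g : MvPolynomial σ ℂ, g.IsHomogeneous d' ∧
              f - X (e 0 ρ) * g ∈ detIdeal e (S (r + 1)) ∧
              ∀ v ∈ detLocus e (S (r + 1)), v (e 0 ρ) * eval v g = 0 := by
          have h1 := ihr (by omega) d f hd fun v hv => hf v ⟨fun t ht => hv.1 t (hSanti r ht), hv.2⟩
          refine (exists_isHomogeneous_sub_X_mul_mem (isHomogeneous_detIdeal e (S (r + 1)))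
            hd (hstep ρ h1)).imp_right ?_
          rintro ⟨d', hd', g, hg, hmem⟩
          refine ⟨d', hd', g, hg, hmem, fun v hv => ?_⟩
          simpa [hf v hv] using eval_eq_zero_of_mem_detIdeal hmem hv
        rcases r with _ | r
        · intro d f hd hf
          obtain h | ⟨d', -, g, hg, hmem, hev⟩ := hvan hd hf
          · exact h
          have h2 : g ∈ detIdeal (fun k l => e (Fin.succ k) (Fin.succ l)) (S 1) := by
            refine ih (fun a b hab => ?_) (fun k l h => ?_) hg fun v hv => ?_
            · have := Prod.ext_iff.1 (@he (a.1.succ, a.2.succ) (b.1.succ, b.2.succ) hab)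
              exact Prod.ext (Fin.succ_injective _ this.1) (Fin.succ_injective _ this.2)
            · exact Fin.succ_ne_zero _ ((hS _ _ _).1 h).1
            · classical
              obtain ⟨hvT, c, hc, hk⟩ := hv
              refine eval_eq_zero_of_curve
                (fun s => Polynomial.C (v s) + if s = e 0 0 then Polynomial.X else 0)
                (a := Polynomial.C (v (e 0 0)) + Polynomial.X) (fun h => ?_) (fun t => ?_)
                fun s => by split_ifs <;> simp
              · simpa [Polynomial.coeff_C] using congrArg (fun p => Polynomial.coeff p 1) h
              · have hmem : (fun s => v s + if s = e 0 0 then t else 0) ∈ detLocus e (S 1) := by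
                  refine ⟨fun s hs => ?_, Fin.cons 0 c, fun h => hc ?_, Fin.cases ?_ fun k => ?_⟩
                  · have : s ≠ e 0 0 := fun h => by
                      have := ((hS 1 0 0).1 (h ▸ hs)).2
                      simp at this
                    simp [hvT s hs, this]
                  · ext l
                    simpa using congrFun h l.succ
                  · rw [Fin.sum_univ_succ]
                    have h0 (l : Fin j) : v (e 0 l.succ) = 0 :=
                      hvT _ ((hS _ _ _).2 ⟨rfl, by simp⟩)
                    have h1 (l : Fin j) : e 0 l.succ ≠ e 0 0 := fun h => by
                      simpa using (Prod.ext_iff.1 (@he (0, l.succ) (0, 0) h)).2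
                    simp [h0, h1]
                  · have h1 (l : Fin j) : e k.succ l.succ ≠ e 0 0 := fun h => by
                      simpa using (Prod.ext_iff.1 (@he (k.succ, l.succ) (0, 0) h)).2
                    simpa [Fin.sum_univ_succ, h1] using hk k
                have := hev _ hmem
                simpa [ρ, apply_ite (Polynomial.eval t)] using this
          have h3 := X_mul_mem_detIdeal (e := e) (fun l hl =>
            (hS 1 0 l).2 ⟨rfl, Nat.one_le_iff_ne_zero.2 fun h => hl (Fin.ext h)⟩) h2
          exact (sub_add_cancel f (X (e 0 0) * g)) ▸ add_mem hmem h3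
        · intro d
          induction d using Nat.strong_induction_on with
          | _ d ihd =>
          intro f hd hf
          obtain h | ⟨d', hd', g, hg, hmem, hev⟩ := hvan hd hf
          · exact h
          have h2 := ihd d' hd' g hg fun v hv => eval_eq_zero_of_mul_eq_zero_on_detLocus he
            (ρ := ρ) (fun h => by simpa [ρ] using congrArg Fin.val h)
            (fun k l h => ((hS _ _ _).1 h)) hev hv
          exact (sub_add_cancel f (X (e 0 ρ) * g)) ▸
            add_mem hmem (Ideal.mul_mem_left _ _ h2)
    have hlast : S (j + 1) = T := by
      refine Set.union_eq_left.2 ?_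
      rintro _ ⟨l, hl, -⟩
      exact absurd l.isLt (by omega)
    rw [← hlast]
    exact main (j + 1) le_rfl d f hd (hlast ▸ hf)

theorem eval_const_mul_of_isHomogeneous {f : MvPolynomial σ ℂ} {d : ℕ} (hf : f.IsHomogeneous d)
    (t : ℂ) (v : σ → ℂ) : eval (fun s => t * v s) f = t ^ d * eval v f := by
  rw [eval_eq, eval_eq, Finset.mul_sum]
  refine Finset.sum_congr rfl fun u hu => ?_
  simp only [mul_pow, Finset.prod_mul_distrib, Finset.prod_pow_eq_pow_sum]
  rw [hf.degree_eq_sum_deg_support hu]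
  ring

theorem mem_detIdeal_iff {e : Fin m → Fin j → σ} {T : Set σ}
    (he : Function.Injective (Function.uncurry e)) (hT : ∀ k l, e k l ∉ T)
    {f : MvPolynomial σ ℂ} : f ∈ detIdeal e T ↔ ∀ v ∈ detLocus e T, eval v f = 0 := by
  refine ⟨fun h v hv => eval_eq_zero_of_mem_detIdeal h hv, fun hf => ?_⟩
  rw [← sum_homogeneousComponent f]
  refine Ideal.sum_mem _ fun i hi => mem_detIdeal_of_isHomogeneous he hT
    (homogeneousComponent_isHomogeneous i f) fun v hv => ?_
  have hcone (t : ℂ) : (fun s => t * v s) ∈ detLocus e T := by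
    obtain ⟨hvT, c, hc, hk⟩ := hv
    refine ⟨fun s hs => by simp [hvT s hs], c, hc, fun k => ?_⟩
    simp [mul_assoc, ← Finset.mul_sum, hk]
  let p : Polynomial ℂ := ∑ i ∈ Finset.range (f.totalDegree + 1),
    Polynomial.C (eval v (homogeneousComponent i f)) * Polynomial.X ^ i
  have hp : p = 0 := Polynomial.funext fun t => by
    have := hf _ (hcone t)
    rw [← sum_homogeneousComponent f, map_sum] at this
    simp only [p, Polynomial.eval_finsetSum, Polynomial.eval_mul, Polynomial.eval_C,
      Polynomial.eval_pow, Polynomial.eval_X, Polynomial.eval_zero]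
    rw [← this]
    refine Finset.sum_congr rfl fun i _ => ?_
    rw [eval_const_mul_of_isHomogeneous (homogeneousComponent_isHomogeneous i f), mul_comm]
  have := congrArg (fun q => Polynomial.coeff q i) hp
  simpa [p, Polynomial.coeff_C_mul, Polynomial.coeff_X_pow, Finset.mem_range.1 hi] using this

end DeterminantalLocus

theorem mem_Lideal_add_Kideal_iff {n : ℕ} [NeZero n] {i j : ℕ} (hj : j ≤ n) {f : R n} :
    f ∈ Lideal n i + Kideal n j ↔ ∀ v : Fin n × Fin n → ℂ, (∀ l : Fin n, (l : ℕ) < i → v (0, l) = 0) →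
      ∀ c : Fin j → ℂ, c ≠ 0 → (∀ r, r ≠ 0 → ∑ l, v (r, Fin.castLE hj l) * c l = 0) →
        eval v f = 0 := by
  constructor
  · intro hf v hv c hc hk
    have hle : Lideal n i + Kideal n j ≤ RingHom.ker (eval v) := by
      refine sup_le (Ideal.span_le.2 ?_) (Ideal.span_le.2 ?_)
      · rintro _ ⟨l, hl, rfl⟩
        simpa using hv l hl
      · rintro _ ⟨_, B, -, hB, rfl⟩
        exact eval_det_eq_zero hc fun k => hk (B k) fun h => hB k (by simp [h])
    exact hle hf
  · intro hf
    let e : Fin (n - 1) → Fin j → Fin n × Fin n :=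
      fun k l => (⟨k + 1, by omega⟩, Fin.castLE hj l)
    let T : Set (Fin n × Fin n) := { s | s.1 = 0 ∧ (s.2 : ℕ) < i }
    have he : Function.Injective (Function.uncurry e) := fun a b hab => by
      have := Prod.mk.inj hab
      simp only [Fin.mk.injEq, Nat.add_right_cancel_iff, Fin.castLE_inj] at this
      exact Prod.ext (Fin.ext this.1) this.2
    have hrow (r : Fin n) (hr : r ≠ 0) : ∃ k : Fin (n - 1), r = ⟨k + 1, by omega⟩ := by
      have : (r : ℕ) ≠ 0 := fun h => hr (Fin.ext (by simpa using h))
      exact ⟨⟨r - 1, by omega⟩, Fin.ext (by simp; omega)⟩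
    have hne (k : Fin (n - 1)) (hk : (k : ℕ) + 1 < n) : (⟨k + 1, hk⟩ : Fin n) ≠ 0 := fun h => by
      simpa using congrArg Fin.val h
    have hmem : f ∈ detIdeal e T := by
      refine (mem_detIdeal_iff he fun k l h => hne k _ h.1).2 ?_
      rintro v ⟨hv, c, hc, hk⟩
      refine hf v (fun l hl => hv _ ⟨rfl, hl⟩) c hc fun r hr => ?_
      obtain ⟨k, rfl⟩ := hrow r hr
      exact hk k
    refine detIdeal_le (fun s hs => ?_) (fun B hB => ?_) hmem
    · obtain ⟨r, l⟩ := s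
      obtain ⟨rfl, hl⟩ := hs
      exact Ideal.mem_sup_left (Ideal.subset_span ⟨l, hl, rfl⟩)
    · refine Ideal.mem_sup_right (Ideal.subset_span ⟨hj, fun k => ⟨B k + 1, by omega⟩,
        fun a b hab => ?_, fun k => by simp, rfl⟩)
      simpa using hB hab

theorem isPrime_Lideal_add_Kideal {n : ℕ} [NeZero n] {i j : ℕ} (hj : j ≤ n) (hj0 : j ≠ 0) :
    (Lideal n i + Kideal n j).IsPrime := by
  let A : Fin n → Fin n → MvPolynomial ((Fin n × Fin n) ⊕ (Fin j ⊕ Fin j)) ℂ :=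
    fun r l => X (Sum.inl (r, l))
  let c : Fin j → MvPolynomial ((Fin n × Fin n) ⊕ (Fin j ⊕ Fin j)) ℂ :=
    fun t => X (Sum.inr (Sum.inl t))
  let d : Fin j → MvPolynomial ((Fin n × Fin n) ⊕ (Fin j ⊕ Fin j)) ℂ :=
    fun t => X (Sum.inr (Sum.inr t))
  let y : Fin n × Fin n → MvPolynomial ((Fin n × Fin n) ⊕ (Fin j ⊕ Fin j)) ℂ := fun s =>
    if s.1 = 0 then (if (s.2 : ℕ) < i then 0 else A s.1 s.2) else
      if h : (s.2 : ℕ) < j then (∑ t, d t * c t) * A s.1 s.2 -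
        (∑ t, A s.1 (Fin.castLE hj t) * c t) * d ⟨s.2, h⟩ else A s.1 s.2
  suffices h : Lideal n i + Kideal n j = RingHom.ker (aeval y : R n →ₐ[ℂ] _) by
    rw [h]
    exact RingHom.ker_isPrime _
  ext f
  rw [mem_Lideal_add_Kideal_iff hj, RingHom.mem_ker]
  constructor
  · intro hf
    refine MvPolynomial.funext fun u => ?_
    rw [map_aeval_eq_eval (by simp), map_zero]
    have hk (r : Fin n) (hr : r ≠ 0) (l : Fin j) : eval u (y (r, Fin.castLE hj l)) =
        (∑ t, u (Sum.inr (Sum.inr t)) * u (Sum.inr (Sum.inl t))) *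
          u (Sum.inl (r, Fin.castLE hj l)) -
        (∑ t, u (Sum.inl (r, Fin.castLE hj t)) * u (Sum.inr (Sum.inl t))) *
          u (Sum.inr (Sum.inr l)) := by
      simp [y, hr, A, c, d]
    by_cases hu : (fun t => u (Sum.inr (Sum.inl t))) = 0
    · have hu' (t) : u (Sum.inr (Sum.inl t)) = 0 := congrFun hu t
      refine hf _ (fun l hl => by simp [y, hl]) (fun _ => 1)
        (fun h => one_ne_zero (congrFun h ⟨0, Nat.pos_of_ne_zero hj0⟩)) fun r hr => ?_
      simp [hk r hr, hu']
    · refine hf _ (fun l hl => by simp [y, hl]) _ hu fun r hr => ?_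
      simp only [hk r hr, sub_mul, Finset.sum_sub_distrib, mul_assoc, ← Finset.mul_sum]
      ring
  · intro hf v hv c' hc hk
    obtain ⟨q, hq⟩ := Function.ne_iff.1 hc
    rw [Pi.zero_apply] at hq
    have := map_aeval_eq_eval (φ := eval (Sum.elim v (Sum.elim c' (Pi.single q (c' q)⁻¹))))
      (by simp) y f
    rw [hf, map_zero] at this
    rw [this]
    congr 2
    ext ⟨r, l⟩
    by_cases hr : r = 0
    · subst hr
      by_cases hl : (l : ℕ) < i
      · simp [y, hl, hv l hl]
      · simp [y, hl, A]
    · by_cases hl : (l : ℕ) < j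
      · simp [y, hr, hl, A, c, d, hk r hr, Pi.single_apply, hq]
      · simp [y, hr, hl, A]

theorem det_submatrix_eq_zero_of_col_mem_span {K ι κ : Type*} [Field K] {q : ℕ} (M : Matrix ι κ K)
    (w : Fin q → ι → K) (hM : ∀ k, M.col k ∈ Submodule.span K (Set.range w))
    (f : Fin (q + 1) → ι) (g : Fin (q + 1) → κ) : (M.submatrix f g).det = 0 := by
  by_contra h
  have hli := Matrix.linearIndependent_cols_of_det_ne_zero h
  have hle : Submodule.span K (Set.range (M.submatrix f g).col) ≤
      Submodule.span K (Set.range fun t => w t ∘ f) := by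
    refine Submodule.span_le.2 ?_
    rintro _ ⟨k, rfl⟩
    have := Submodule.mem_map_of_mem (f := LinearMap.funLeft K K f) (hM (g k))
    rw [Submodule.map_span, ← Set.range_comp] at this
    exact this
  have h1 := finrank_span_eq_card hli
  have h2 := Submodule.finrank_mono hle
  have h3 : Module.finrank K (Submodule.span K (Set.range fun t => w t ∘ f)) ≤ q := by
    simpa [Set.finrank] using finrank_range_le_card (R := K) fun t => w t ∘ f
  rw [Fintype.card_fin] at h1
  omega

theorem hessIdeal_le {n : ℕ} [NeZero n] {h : Fin n → Fin n} (hh : IsHessenberg n h) (i : Fin n) :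
    hessIdeal n (sMat n) h ≤ Lideal n i + Kideal n (h i + 1) := by
  have hj (a : Fin n) : (h a : ℕ) + 1 ≤ n := (h a).isLt
  intro p hp
  rw [mem_Lideal_add_Kideal_iff (hj i)]
  intro v hv c hc hk
  suffices hessIdeal n (sMat n) h ≤ RingHom.ker (eval v) from this hp
  rw [hessIdeal, Ideal.sum_eq_sup]
  refine Finset.sup_le fun a _ => Ideal.span_le.2 ?_
  rintro _ ⟨f, g, rfl⟩
  rw [SetLike.mem_coe, RingHom.mem_ker, RingHom.map_det]
  let M : Matrix (Fin n) (Fin (a + 1) ⊕ Fin (h a + 1)) ℂ := (hessMat n (sMat n) h a).map (eval v)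
  let col : Fin (h a + 1) → Fin n → ℂ := fun l r => v (r, Fin.castLE (hj a) l)
  have hMl (l) : M.col (Sum.inl l) = Pi.single 0 (v (0, Fin.castLE a.isLt l)) := by
    ext r
    by_cases hr : r = 0 <;> simp [M, hessMat, sMat, Matrix.diagonal_apply, hr]
  have hMr (l) : M.col (Sum.inr l) = col l := by
    ext r
    simp [M, hessMat, col]
  suffices ∃ w : Fin (h a + 1) → Fin n → ℂ, ∀ k, M.col k ∈ Submodule.span ℂ (Set.range w) by
    obtain ⟨w, hw⟩ := this
    exact det_submatrix_eq_zero_of_col_mem_span M w hw f g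
  rcases lt_or_ge a i with hai | hia
  · refine ⟨col, Sum.rec (fun l => ?_) fun l => ?_⟩
    · rw [hMl, hv _ (by simp; omega), Pi.single_zero]
      exact Submodule.zero_mem _
    · rw [hMr]
      exact Submodule.subset_span ⟨l, rfl⟩
  · obtain ⟨q, hq⟩ := Function.ne_iff.1 hc
    have hle : (h i : ℕ) + 1 ≤ h a + 1 := Nat.succ_le_succ (hh.1 hia)
    let w : Fin (h a + 1) → Fin n → ℂ :=
      Function.update col (Fin.castLE hle q) (Pi.single 0 1)
    have hsingle (z : ℂ) : Pi.single 0 z ∈ Submodule.span ℂ (Set.range w) := by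
      have : w (Fin.castLE hle q) ∈ Submodule.span ℂ (Set.range w) :=
        Submodule.subset_span ⟨_, rfl⟩
      have := Submodule.smul_mem _ z this
      rwa [show w (Fin.castLE hle q) = Pi.single 0 1 from Function.update_self .., ← Pi.single_smul,
        smul_eq_mul, mul_one] at this
    have hcol (l) (hl : l ≠ Fin.castLE hle q) : col l ∈ Submodule.span ℂ (Set.range w) :=
      Submodule.subset_span ⟨l, Function.update_of_ne hl ..⟩
    refine ⟨w, Sum.rec (fun l => hMl l ▸ hsingle _) fun l => ?_⟩
    rw [hMr]
    by_cases hl : l = Fin.castLE hle q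
    · rw [hl, ← Submodule.smul_mem_iff _ hq]
      have hsum : ∑ t, c t • col (Fin.castLE hle t) ∈ Submodule.span ℂ (Set.range w) := by
        convert hsingle (∑ t, c t * v (0, Fin.castLE (hj i) t)) using 1
        ext r
        by_cases hr : r = 0
        · subst hr
          simp [col]
        · simpa [col, hr, mul_comm] using hk r hr
      rw [← Finset.add_sum_erase _ _ (Finset.mem_univ q)] at hsum
      refine (Submodule.add_mem_iff_left _ (Submodule.sum_mem _ fun t ht => ?_)).1 hsum
      refine Submodule.smul_mem _ _ (hcol _ fun h => ?_)
      exact Finset.ne_of_mem_erase ht (Fin.castLE_injective hle h)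
    · exact hcol l hl

theorem hessIdealAt_le_hessIdeal {n : ℕ} (x : Matrix (Fin n) (Fin n) ℂ) (h : Fin n → Fin n)
    (a : Fin n) : hessIdealAt n x h a ≤ hessIdeal n x h := by
  rw [hessIdeal, Ideal.sum_eq_sup]
  exact Finset.le_sup (f := hessIdealAt n x h) (Finset.mem_univ a)

theorem Kideal_le_of_X_notMem {n : ℕ} [NeZero n] {h : Fin n → Fin n} {P : Ideal (R n)}
    (hPp : P.IsPrime) {a : Fin n} (hP : hessIdealAt n (sMat n) h a ≤ P) (ha : X (0, a) ∉ P) :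
    Kideal n (h a + 1) ≤ P := by
  refine Ideal.span_le.2 ?_
  rintro _ ⟨hj, B, -, hB, rfl⟩
  have hB' (k) : B k ≠ 0 := fun h => hB k (by simp [h])
  refine (hPp.mem_or_mem (?_ : X (0, a) * _ ∈ P)).resolve_left ha
  refine hP (Ideal.subset_span ⟨Fin.cons 0 B, Fin.cons (Sum.inl (Fin.last a)) Sum.inr, ?_⟩)
  symm
  rw [Matrix.det_succ_column_zero, Fin.sum_univ_succ]
  have hlast : Fin.castLE a.isLt (Fin.last a) = a := Fin.ext rfl
  have h0 : hessMat n (sMat n) h a 0 (Sum.inl (Fin.last a)) = X (0, a) := by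
    simp [hessMat, sMat, Matrix.diagonal_apply, hlast]
  have hs (k) : hessMat n (sMat n) h a (B k) (Sum.inl (Fin.last a)) = 0 := by
    simp [hessMat, sMat, Matrix.diagonal_apply, hB']
  simp only [Matrix.submatrix_apply, Fin.cons_zero, Fin.cons_succ, h0, hs, mul_zero, zero_mul,
    Finset.sum_const_zero, add_zero, Fin.val_zero, pow_zero, one_mul]
  congr 2

theorem exists_hessCorner_eq {n : ℕ} (h : Fin n → Fin n) (a : Fin n) (hh : Monotone h) :
    ∃ i ≤ a, HessCorner n h i ∧ h i = h a := by
  obtain ⟨i, hi, hmin⟩ := WellFounded.has_min (wellFounded_lt (α := Fin n)) { i | h i = h a }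
    ⟨a, rfl⟩
  refine ⟨i, not_lt.1 (hmin a rfl), ?_, hi⟩
  by_cases h0 : (i : ℕ) = 0
  · exact Or.inl h0
  · have hlt : (⟨(i : ℕ) - 1, lt_of_le_of_lt (Nat.sub_le _ _) i.isLt⟩ : Fin n) < i :=
      Fin.lt_def.2 (by simp; omega)
    exact Or.inr ((hh hlt.le).lt_of_ne fun h => hmin _ (h.trans hi) hlt)

theorem exists_hessCorner_le {n : ℕ} [NeZero n] {h : Fin n → Fin n} (hh : IsHessenberg n h)
    {P : Ideal (R n)} (hPp : P.IsPrime) (hP : hessIdeal n (sMat n) h ≤ P) :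
    ∃ i, HessCorner n h i ∧ Lideal n i + Kideal n (h i + 1) ≤ P := by
  obtain ⟨a, ha, hK⟩ : ∃ a : Fin n, (∀ b < a, X (0, b) ∈ P) ∧ Kideal n (h a + 1) ≤ P := by
    by_cases hX : ∃ a : Fin n, X (0, a) ∉ P
    · obtain ⟨a, ha, hmin⟩ := WellFounded.has_min (wellFounded_lt (α := Fin n))
        { a | X (0, a) ∉ P } hX
      exact ⟨a, fun b hb => by_contra fun h => hmin b h hb,
        Kideal_le_of_X_notMem hPp ((hessIdealAt_le_hessIdeal _ _ _).trans hP) ha⟩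
    · push Not at hX
      have hn : n - 1 < n := Nat.sub_lt (NeZero.pos n) one_pos
      have : (h ⟨n - 1, hn⟩ : ℕ) + 1 = n := by
        have := Fin.le_def.1 (hh.2 ⟨n - 1, hn⟩)
        simp only at this
        omega
      exact ⟨⟨n - 1, hn⟩, fun b _ => hX b, by rw [this, Kideal_self]; exact bot_le⟩
  obtain ⟨i, hia, hi, hia'⟩ := exists_hessCorner_eq h a hh.1
  refine ⟨i, hi, sup_le (Ideal.span_le.2 ?_) (hia' ▸ hK)⟩
  rintro _ ⟨l, hl, rfl⟩
  exact ha l (lt_of_lt_of_le (Fin.lt_def.2 hl) hia)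

theorem HessCorner.lt_of_lt {n : ℕ} {h : Fin n → Fin n} (hh : Monotone h) {i j : Fin n}
    (hj : HessCorner n h j) (hij : i < j) : h i < h j := by
  have hij' := Fin.lt_def.1 hij
  exact (hh (Fin.le_def.2 (by simp; omega))).trans_lt (hj.resolve_left (by omega))

theorem not_Lideal_add_Kideal_le_of_lt_right {n : ℕ} [NeZero n] {i i' j j' : ℕ} (hjj' : j < j')
    (hj' : j' ≤ n) : ¬ Lideal n i + Kideal n j ≤ Lideal n i' + Kideal n j' := by
  intro hle
  let B : Fin j → Fin n := fun k => ⟨k + 1, by omega⟩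
  let v : Fin n × Fin n → ℂ := fun s => if (s.1 : ℕ) = s.2 + 1 ∧ (s.2 : ℕ) < j then 1 else 0
  have hmem : (Matrix.of fun k l : Fin j => (X (B k, Fin.castLE (by omega) l) : R n)).det ∈
      Lideal n i + Kideal n j :=
    Ideal.mem_sup_right (Ideal.subset_span
      ⟨by omega, B, fun a b hab => by simpa [B] using hab, fun k => by simp [B], rfl⟩)
  have := (mem_Lideal_add_Kideal_iff hj').1 (hle hmem) v (fun l _ => by simp [v])
    (Pi.single ⟨j, hjj'⟩ 1) (by simp) fun r _ => by simp [v, Pi.single_apply]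
  rw [RingHom.map_det] at this
  refine one_ne_zero (α := ℂ) (Eq.trans ?_ this)
  rw [← Matrix.det_one (n := Fin j)]
  congr 1
  ext k l
  simp [v, B, Matrix.one_apply, Fin.ext_iff]

theorem not_Lideal_add_Kideal_le_of_lt_left {n : ℕ} [NeZero n] {i' j j' : ℕ} {i : Fin n}
    (hii' : i < i') (hj : j ≤ n) (hj0 : j ≠ 0) :
    ¬ Lideal n i' + Kideal n j' ≤ Lideal n i + Kideal n j := by
  intro hle
  have hmem : X (0, i) ∈ Lideal n i' + Kideal n j' :=
    Ideal.mem_sup_left (Ideal.subset_span ⟨i, hii', rfl⟩)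
  have := (mem_Lideal_add_Kideal_iff hj).1 (hle hmem) (Pi.single (0, i) 1)
    (fun l hl => Pi.single_eq_of_ne (fun h => hl.ne (congrArg Fin.val (Prod.mk.inj h).2)) _)
    1 (fun h => one_ne_zero (congrFun h ⟨0, Nat.pos_of_ne_zero hj0⟩))
    fun r hr => by simp [hr]
  simp at this

theorem not_Lideal_add_Kideal_le_of_ne {n : ℕ} [NeZero n] {h : Fin n → Fin n} (hh : Monotone h)
    {i j : Fin n} (hj : HessCorner n h j) (hij : i ≠ j) :
    ¬ Lideal n i + Kideal n (h i + 1) ≤ Lideal n j + Kideal n (h j + 1) := by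
  rcases hij.lt_or_gt with hlt | hlt
  · exact not_Lideal_add_Kideal_le_of_lt_right
      (Nat.succ_lt_succ (Fin.lt_def.1 (hj.lt_of_lt hh hlt))) (h j).isLt
  · exact not_Lideal_add_Kideal_le_of_lt_left (Fin.lt_def.1 hlt) (h j).isLt (Nat.succ_ne_zero _)

/-- the minimal primes over `I_{s,h}` are exactly the ideals
`L_{i-1} + K_{h(i)}` for corners `i ∈ C(h)`; moreover for distinct corners these primes are
distinct and neither contains the other. -/
theorem stmt2 (n : ℕ) [NeZero n] (h : Fin n → Fin n) (hh : IsHessenberg n h) :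
    (hessIdeal n (sMat n) h).minimalPrimes =
      { P : Ideal (R n) | ∃ i : Fin n, HessCorner n h i ∧
          P = Lideal n (i : ℕ) + Kideal n (((h i) : ℕ) + 1) } ∧
    ∀ i j : Fin n, HessCorner n h i → HessCorner n h j → i ≠ j →
      (Lideal n (i : ℕ) + Kideal n (((h i) : ℕ) + 1) ≠
        Lideal n (j : ℕ) + Kideal n (((h j) : ℕ) + 1)) ∧
      ¬ (Lideal n (i : ℕ) + Kideal n (((h i) : ℕ) + 1) ≤
          Lideal n (j : ℕ) + Kideal n (((h j) : ℕ) + 1)) := by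
  have hprime (i : Fin n) : (Lideal n i + Kideal n (h i + 1)).IsPrime :=
    isPrime_Lideal_add_Kideal (h i).isLt (Nat.succ_ne_zero _)
  refine ⟨Set.ext fun P => ⟨fun hP => ?_, ?_⟩, fun i j _ hj hij => ?_⟩
  · obtain ⟨i, hi, hle⟩ := exists_hessCorner_le hh hP.1.1 hP.1.2
    exact ⟨i, hi, (hP.2 ⟨hprime i, hessIdeal_le hh i⟩ hle).antisymm hle⟩
  · rintro ⟨i, hi, rfl⟩
    refine ⟨⟨hprime i, hessIdeal_le hh i⟩, fun Q hQ hle => ?_⟩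
    obtain ⟨j, -, hjQ⟩ := exists_hessCorner_le hh hQ.1 hQ.2
    obtain rfl : j = i :=
      by_contra fun hji => not_Lideal_add_Kideal_le_of_ne hh.1 hi hji (hjQ.trans hle)
    exact hjQ
  · have := not_Lideal_add_Kideal_le_of_ne hh.1 hj hij
    exact ⟨fun heq => this heq.le, this⟩
end
end

section
/- For all integers i, j with 0 ≤ i ≤ n−1 and 1 ≤ j ≤ n, the ideal L_i + K_j ⊆ R is a prime ideal. -/
open MvPolynomial

noncomputable section

section MaximalMinors

variable {K σ ρ : Type*} [Field K]

/-- The ideal generated by the variables indexed by `Z` and the maximal minors, on rows in `A`,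
of the matrix of variables with entries `X (x a l)`. -/
def minorIdeal (K : Type*) [Field K] {j : ℕ} (x : ρ → Fin j → σ) (A : Finset ρ) (Z : Set σ) :
    Ideal (MvPolynomial σ K) :=
  Ideal.span (X '' Z ∪ {p | ∃ B : Fin j → ρ, (∀ k, B k ∈ A) ∧
    p = (Matrix.of fun k l : Fin j => (X (x (B k) l) : MvPolynomial σ K)).det})

/-- The points with vanishing coordinates in `Z` at which the matrix with entries `p (x a l)`,
`a ∈ A`, has a nonzero kernel vector. -/
def kernelLocus (K : Type*) [Field K] {j : ℕ} (x : ρ → Fin j → σ) (A : Finset ρ) (Z : Set σ) :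
    Set (σ → K) :=
  {p | (∀ z ∈ Z, p z = 0) ∧ ∃ v : Fin j → K, v ≠ 0 ∧ ∀ a ∈ A, ∑ l, p (x a l) * v l = 0}

theorem X_mem_minorIdeal {j : ℕ} {x : ρ → Fin j → σ} {A : Finset ρ} {Z : Set σ} {z : σ}
    (hz : z ∈ Z) : X z ∈ minorIdeal K x A Z :=
  Ideal.subset_span (Or.inl ⟨z, hz, rfl⟩)

theorem det_mem_minorIdeal {j : ℕ} {x : ρ → Fin j → σ} {A : Finset ρ} {Z : Set σ}
    {B : Fin j → ρ} (hB : ∀ k, B k ∈ A) :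
    (Matrix.of fun k l : Fin j => (X (x (B k) l) : MvPolynomial σ K)).det ∈ minorIdeal K x A Z :=
  Ideal.subset_span (Or.inr ⟨B, hB, rfl⟩)

theorem minorIdeal_le {j : ℕ} {x : ρ → Fin j → σ} {A : Finset ρ} {Z : Set σ}
    {I : Ideal (MvPolynomial σ K)} (hX : ∀ z ∈ Z, X z ∈ I)
    (hdet : ∀ B : Fin j → ρ, (∀ k, B k ∈ A) →
      (Matrix.of fun k l : Fin j => (X (x (B k) l) : MvPolynomial σ K)).det ∈ I) :
    minorIdeal K x A Z ≤ I := by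
  refine Ideal.span_le.2 ?_
  rintro _ (⟨z, hz, rfl⟩ | ⟨B, hB, rfl⟩)
  exacts [hX z hz, hdet B hB]

theorem minorIdeal_mono {j : ℕ} {x : ρ → Fin j → σ} {A A' : Finset ρ} {Z : Set σ} (h : A ⊆ A') :
    minorIdeal K x A Z ≤ minorIdeal K x A' Z :=
  minorIdeal_le (fun _ hz => X_mem_minorIdeal hz) fun _ hB => det_mem_minorIdeal fun k => h (hB k)

theorem mem_minorIdeal_insert {j : ℕ} {x : ρ → Fin j → σ} {A : Finset ρ} {Z : Set σ} {z : σ}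
    {f : MvPolynomial σ K} (hf : f ∈ minorIdeal K x A (insert z Z)) :
    ∃ h, f - h * X z ∈ minorIdeal K x A Z := by
  rw [minorIdeal, Set.image_insert_eq, Set.insert_union, Ideal.mem_span_insert] at hf
  obtain ⟨h, u, hu, rfl⟩ := hf
  exact ⟨h, by rwa [add_sub_cancel_left]⟩

theorem eval_eq_zero_of_mem_minorIdeal {j : ℕ} {x : ρ → Fin j → σ} {A : Finset ρ} {Z : Set σ}
    {f : MvPolynomial σ K} (hf : f ∈ minorIdeal K x A Z) {p : σ → K}
    (hp : p ∈ kernelLocus K x A Z) : eval p f = 0 := by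
  obtain ⟨hZ, v, hv, hpv⟩ := hp
  suffices H : minorIdeal K x A Z ≤ RingHom.ker (eval p) from H hf
  refine minorIdeal_le (fun z hz => ?_) fun B hB => ?_
  · simpa using hZ z hz
  · rw [RingHom.mem_ker, RingHom.map_det, ← Matrix.exists_mulVec_eq_zero_iff]
    refine ⟨v, hv, ?_⟩
    ext k
    simpa [Matrix.mulVec, dotProduct] using hpv (B k) (hB k)

theorem homogeneousComponent_mem_minorIdeal {j : ℕ} {x : ρ → Fin j → σ} {A : Finset ρ}
    {Z : Set σ} {f : MvPolynomial σ K} (hf : f ∈ minorIdeal K x A Z) (d : ℕ) :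
    homogeneousComponent d f ∈ minorIdeal K x A Z := by
  let := MvPolynomial.gradedAlgebra (σ := σ) (R := K)
  refine (mem_iff_homogeneousComponent_mem (Ideal.homogeneous_span _ _ ?_) f).1 hf d
  rintro _ (⟨z, hz, rfl⟩ | ⟨B, hB, rfl⟩)
  · exact ⟨1, isHomogeneous_X K z⟩
  · refine ⟨j, ?_⟩
    rw [mem_homogeneousSubmodule, Matrix.det_apply]
    refine IsHomogeneous.sum _ _ _ fun τ _ => ?_
    have h : IsHomogeneous (∏ k : Fin j, (X (x (B (τ k)) k) : MvPolynomial σ K)) j := by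
      simpa using IsHomogeneous.prod Finset.univ
        (fun k : Fin j => (X (x (B (τ k)) k) : MvPolynomial σ K)) (fun _ => 1)
        fun k _ => isHomogeneous_X K _
    rcases Int.units_eq_one_or (Equiv.Perm.sign τ) with hs | hs
    · simpa [hs] using h
    · simpa [hs] using h.neg

theorem homogeneousComponent_mul_X_pow_eq_zero {d N : ℕ} (h : d < N) (z : σ)
    (q : MvPolynomial σ K) : homogeneousComponent d (q * X z ^ N) = 0 := by
  classical
  ext e
  rw [coeff_homogeneousComponent, X_pow_eq_monomial, coeff_mul_monomial', coeff_zero]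
  split_ifs with h1 h2
  · exfalso
    have h3 := Finsupp.single_le_iff.1 h2
    have h4 := Finsupp.le_degree z e
    omega
  all_goals rfl

/-- A graded Nakayama argument. -/
theorem mem_of_forall_exists_sub_mul_X_mem {I : Ideal (MvPolynomial σ K)}
    (hI : ∀ f ∈ I, ∀ d, homogeneousComponent d f ∈ I) {P : MvPolynomial σ K → Prop} {z : σ}
    (h : ∀ f, P f → ∃ q, P q ∧ f - q * X z ∈ I) {f : MvPolynomial σ K} (hf : P f) : f ∈ I := by
  have key : ∀ N : ℕ, ∃ q, P q ∧ f - q * X z ^ N ∈ I := by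
    intro N
    induction N with
    | zero => exact ⟨f, hf, by simp⟩
    | succ N ih =>
      obtain ⟨q, hq, hqI⟩ := ih
      obtain ⟨q', hq', hqI'⟩ := h q hq
      refine ⟨q', hq', ?_⟩
      have := I.add_mem hqI (I.mul_mem_right (X z ^ N) hqI')
      ring_nf at this ⊢
      exact this
  obtain ⟨q, -, hq⟩ := key (f.totalDegree + 1)
  rw [← sum_homogeneousComponent f]
  refine I.sum_mem fun d hd => ?_
  have := hI _ hq d
  rwa [map_sub, homogeneousComponent_mul_X_pow_eq_zero (Finset.mem_range.1 hd), sub_zero] at this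

theorem eval_eq_zero_of_line [Infinite K] (f : MvPolynomial σ K) (p d : σ → K)
    (h : ∀ t : K, t ≠ 0 → eval (p + t • d) f = 0) : eval p f = 0 := by
  set F : Polynomial K := aeval (fun z => Polynomial.C (p z) + Polynomial.X * Polynomial.C (d z)) f
    with hF
  have hev : ∀ t, F.eval t = eval (p + t • d) f := by
    intro t
    rw [hF, ← Polynomial.coe_evalRingHom, aeval_def, hom_eval₂, eval₂_eq_eval_map]
    have h1 : (Polynomial.evalRingHom t).comp (algebraMap K (Polynomial K)) = RingHom.id K := by
      ext; simp
    rw [h1, map_id]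
    congr 2
    ext z
    simp [mul_comm (d z)]
  have h0 : F = 0 := by
    refine Polynomial.eq_zero_of_infinite_isRoot _ (Set.Infinite.mono (s := {0}ᶜ) ?_
      (Set.finite_singleton 0).infinite_compl)
    intro t ht
    exact (hev t).trans (h t ht)
  have := hev 0
  rw [h0, Polynomial.eval_zero, zero_smul, add_zero] at this
  exact this.symm

/-- A variable in the row `a` is a nonzerodivisor modulo the vanishing ideal of `kernelLocus`,
as long as another entry of that row is free. -/
theorem eval_eq_zero_of_mul_X [Infinite K] {j : ℕ} {x : ρ → Fin j → σ}
    (hx : Function.Injective (Function.uncurry x)) {A : Finset ρ} {Z : Set σ} {a : ρ}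
    {r l : Fin j} (hrl : r ≠ l) (hr : ∀ b ∈ A, x b r ∉ Z) (ha : a ∈ A) (hl : x a l ∉ Z)
    {q : MvPolynomial σ K} (h : ∀ p ∈ kernelLocus K x A Z, eval p (q * X (x a r)) = 0) :
    ∀ p ∈ kernelLocus K x A Z, eval p q = 0 := by
  classical
  have hx' : ∀ b b' k k', x b k = x b' k' ↔ b = b' ∧ k = k' := fun b b' k k' =>
    (hx.eq_iff (a := (b, k)) (b := (b', k'))).trans Prod.mk_inj
  have h' : ∀ p ∈ kernelLocus K x A Z, p (x a r) ≠ 0 → eval p q = 0 := by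
    intro p hp hne
    simpa [hne] using h p hp
  -- move `p (x a r)` and `p (x a l)` inside the orthogonal complement of the kernel vector
  have move : ∀ (p : σ → K) (v : Fin j → K), (∀ z ∈ Z, p z = 0) → v ≠ 0 →
      (∀ b ∈ A, ∑ k, p (x b k) * v k = 0) →
      ∀ c c' : K, c ≠ 0 → c * v r + c' * v l = 0 → eval p q = 0 := by
    intro p v hp hv hpv c c' hc hcc
    by_cases hne : p (x a r) = 0
    swap
    · exact h' p ⟨hp, v, hv, hpv⟩ hne
    refine eval_eq_zero_of_line q p (Pi.single (x a r) c + Pi.single (x a l) c') fun t ht => ?_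
    refine h' _ ⟨fun z hz => ?_, v, hv, fun b hb => ?_⟩ ?_
    · have h1 : z ≠ x a r := fun e => hr a ha (e ▸ hz)
      have h2 : z ≠ x a l := fun e => hl (e ▸ hz)
      simp [hp z hz, h1, h2]
    · by_cases hba : b = a
      · subst hba
        have : ∑ k, (t * ((Pi.single r c : Fin j → K) k * v k) +
            t * ((Pi.single l c' : Fin j → K) k * v k)) = 0 := by
          rw [Finset.sum_add_distrib, ← Finset.mul_sum, ← Finset.mul_sum]
          simp only [Pi.single_apply, ite_mul, zero_mul, Finset.sum_ite_eq', Finset.mem_univ,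
            if_true]
          rw [← mul_add, hcc, mul_zero]
        rw [← add_zero (0 : K)]
        nth_rewrite 1 [← hpv b hb]
        rw [← this, ← Finset.sum_add_distrib]
        refine Finset.sum_congr rfl fun k _ => ?_
        simp only [Pi.add_apply, Pi.smul_apply, Pi.single_apply, hx', true_and, smul_eq_mul]
        ring
      · rw [← hpv b hb]
        refine Finset.sum_congr rfl fun k _ => ?_
        simp [hx', hba]
    · simp [hne, hx', hrl, hc, ht]
  rintro p ⟨hp, v, hv, hpv⟩
  by_cases hvl : v l = 0
  swap
  · exact move p v hp hv hpv (v l) (-v r) hvl (by ring)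
  by_cases hvr : v r = 0
  · exact move p v hp hv hpv 1 0 one_ne_zero (by simp [hvr])
  -- perturb the kernel vector at `l`, correcting the column `r` of the matrix
  set d : σ → K := Function.extend (Function.uncurry x)
    (fun bk => if bk.1 ∈ A ∧ bk.2 = r then -(p (x bk.1 l) / v r) else 0) 0 with hd
  have hdx : ∀ b k, d (x b k) = if b ∈ A ∧ k = r then -(p (x b l) / v r) else 0 := fun b k =>
    hx.extend_apply _ _ (b, k)
  refine eval_eq_zero_of_line q p d fun t ht => ?_
  set u : Fin j → K := v + Pi.single l t with hu
  refine move _ u (fun z hz => ?_) (fun h0 => ?_) (fun b hb => ?_)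
    (u l) (-u r) (by simp [hu, hvl, ht]) (by ring)
  · have hdz : d z = 0 := by
      by_cases hzx : ∃ bk, Function.uncurry x bk = z
      · obtain ⟨⟨b, k⟩, rfl⟩ := hzx
        simp only [Function.uncurry_apply_pair] at hz ⊢
        rw [hdx, if_neg]
        rintro ⟨hb, rfl⟩
        exact hr b hb hz
      · rw [hd, Function.extend_apply' _ _ _ hzx, Pi.zero_apply]
    simp [hp z hz, hdz]
  · have := congrFun h0 l
    simp [hu, hvl, ht] at this
  · have e : ∀ k, (p + t • d) (x b k) * u k
        = p (x b k) * v k + (if k = l then p (x b l) * t else 0)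
          + if k = r then -(p (x b l) * t) else 0 := by
      intro k
      simp only [hu, Pi.add_apply, Pi.smul_apply, smul_eq_mul, hdx, hb, true_and, Pi.single_apply]
      by_cases hkr : k = r
      · subst hkr
        simp only [hrl, if_true, if_false]
        field_simp
        ring
      · by_cases hkl : k = l
        · subst hkl; simp [hkr]; ring
        · simp [hkr, hkl]
    simp_rw [e, Finset.sum_add_distrib, hpv b hb]
    simp

theorem mem_span_X_of_forall_eval_eq_zero [Infinite K] {Z : Set σ} {f : MvPolynomial σ K}
    (hf : ∀ p : σ → K, (∀ z ∈ Z, p z = 0) → eval p f = 0) :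
    f ∈ Ideal.span (X '' Z : Set (MvPolynomial σ K)) := by
  classical
  set I := Ideal.span (X '' Z : Set (MvPolynomial σ K))
  set φ : MvPolynomial σ K →ₐ[K] MvPolynomial σ K :=
    aeval fun z => if z ∈ Z then 0 else X z with hφ
  have h1 : φ f = 0 := by
    refine MvPolynomial.funext fun p => ?_
    rw [map_zero, ← hf (fun z => if z ∈ Z then 0 else p z) (by simp +contextual), hφ, aeval_def,
      hom_eval₂, eval₂_eq_eval_map]
    have h1 : (eval p).comp (algebraMap K (MvPolynomial σ K)) = RingHom.id K := by
      ext; simp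
    rw [h1, map_id]
    congr 2
    ext z
    split_ifs <;> simp_all
  have h2 : (Ideal.Quotient.mkₐ K I).comp φ = Ideal.Quotient.mkₐ K I := by
    ext z
    simp only [hφ, AlgHom.comp_apply, aeval_X]
    split_ifs with hz
    · rw [map_zero, eq_comm]
      exact Ideal.Quotient.eq_zero_iff_mem.2 (Ideal.subset_span ⟨z, hz, rfl⟩)
    · rfl
  rw [← Ideal.Quotient.eq_zero_iff_mem]
  have h3 := DFunLike.congr_fun h2 f
  rw [AlgHom.comp_apply, h1, map_zero] at h3
  exact h3.symm

theorem minorIdeal_le_castSucc {s : ℕ} {x : ρ → Fin (s + 1) → σ} {A : Finset ρ} {Z : Set σ} :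
    minorIdeal K x A Z ≤ minorIdeal K (fun b (k : Fin s) => x b k.castSucc) A Z := by
  refine minorIdeal_le (fun _ hz => X_mem_minorIdeal hz) fun B hB => ?_
  rw [Matrix.det_succ_column _ (Fin.last s)]
  refine Ideal.sum_mem _ fun k _ => Ideal.mul_mem_left _ _ ?_
  have := det_mem_minorIdeal (K := K) (x := fun b (k : Fin s) => x b k.castSucc) (A := A) (Z := Z)
    (B := fun i => B (k.succAbove i)) fun i => hB _
  convert this using 2
  ext i l
  simp

theorem X_mul_mem_minorIdeal {s : ℕ} {x : ρ → Fin (s + 1) → σ} {A A' : Finset ρ} {Z : Set σ}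
    {a : ρ} (hA : A' ⊆ A) (ha : a ∈ A) (hZ : ∀ k : Fin s, x a k.castSucc ∈ Z)
    {h : MvPolynomial σ K} (hh : h ∈ minorIdeal K (fun b (k : Fin s) => x b k.castSucc) A' Z) :
    h * X (x a (Fin.last s)) ∈ minorIdeal K x A Z := by
  suffices H : minorIdeal K (fun b (k : Fin s) => x b k.castSucc) A' Z ≤
      Submodule.comap (LinearMap.mulRight (MvPolynomial σ K) (X (x a (Fin.last s))))
        (minorIdeal K x A Z) from H hh
  refine minorIdeal_le (fun z hz => Ideal.mul_mem_right _ _ (X_mem_minorIdeal hz)) fun B hB => ?_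
  have hmem := det_mem_minorIdeal (K := K) (x := x) (A := A) (Z := Z)
    (B := Fin.snoc (α := fun _ => ρ) B a) fun k => by
      induction k using Fin.lastCases with
      | last => simpa using ha
      | cast k => simpa using hA (hB k)
  rw [Matrix.det_succ_row _ (Fin.last s), Fin.sum_univ_castSucc, Ideal.add_mem_iff_right] at hmem
  · have hsub : ((Matrix.of fun k l : Fin (s + 1) =>
        (X (x (Fin.snoc (α := fun _ => ρ) B a k) l) : MvPolynomial σ K)).submatrix
          (Fin.last s).succAbove (Fin.last s).succAbove) =
        Matrix.of fun k l : Fin s => X (x (B k) l.castSucc) := by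
      ext k l : 2
      simp
    rw [hsub] at hmem
    simpa [mul_comm, ← two_mul, pow_mul'] using hmem
  · refine Ideal.sum_mem _ fun k _ => Ideal.mul_mem_right _ _ (Ideal.mul_mem_left _ _ ?_)
    simpa using X_mem_minorIdeal (hZ k)

/-- Every polynomial vanishing on `kernelLocus` lies in `minorIdeal`. -/
theorem mem_minorIdeal_of_forall_eval_eq_zero [Infinite K] (A : Finset ρ) :
    ∀ {j : ℕ} {x : ρ → Fin j → σ} (_ : Function.Injective (Function.uncurry x)) {Z : Set σ}
      (_ : ∀ a ∈ A, ∀ l, x a l ∉ Z) {f : MvPolynomial σ K}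
      (_ : ∀ p ∈ kernelLocus K x A Z, eval p f = 0), f ∈ minorIdeal K x A Z := by
  classical
  induction A using Finset.induction_on with
  | empty =>
    intro j x hx Z hZ f hf
    rcases j with _ | s
    · have := det_mem_minorIdeal (K := K) (x := x) (A := ∅) (Z := Z) (B := Fin.elim0) (fun k => k.elim0)
      rw [Matrix.det_isEmpty] at this
      rw [(Ideal.eq_top_iff_one _).2 this]
      trivial
    · refine Ideal.span_mono Set.subset_union_left (mem_span_X_of_forall_eval_eq_zero fun p hp => ?_)
      exact hf p ⟨hp, 1, one_ne_zero, by simp⟩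
  | insert a A ha ih =>
    intro j x hx Z hZ f hf
    rcases j with _ | s
    · have := det_mem_minorIdeal (K := K) (x := x) (A := insert a A) (Z := Z) (B := Fin.elim0)
        (fun k => k.elim0)
      rw [Matrix.det_isEmpty] at this
      rw [(Ideal.eq_top_iff_one _).2 this]
      trivial
    have hx' : ∀ b b' k k', x b k = x b' k' ↔ b = b' ∧ k = k' := fun b b' k k' =>
      (hx.eq_iff (a := (b, k)) (b := (b', k'))).trans Prod.mk_inj
    have haA : ∀ {b}, b ∈ A → b ≠ a := fun hb e => ha (e ▸ hb)
    set W : ℕ → Set σ := fun r => Z ∪ {z | ∃ l : Fin (s + 1), (l : ℕ) < r ∧ z = x a l} with hW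
    have hWsucc : ∀ r : Fin (s + 1), W (r + 1) = insert (x a r) (W r) := by
      intro r
      ext z
      simp only [hW, Set.mem_union, Set.mem_ofPred_eq, Set.mem_insert_iff]
      constructor
      · rintro (hz | ⟨l, hl, rfl⟩)
        · exact Or.inr (Or.inl hz)
        · rcases Nat.lt_succ_iff_lt_or_eq.1 hl with hl | hl
          · exact Or.inr (Or.inr ⟨l, hl, rfl⟩)
          · exact Or.inl (by rw [Fin.ext hl])
      · rintro (rfl | hz | ⟨l, hl, rfl⟩)
        · exact Or.inr ⟨r, Nat.lt_succ_self _, rfl⟩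
        · exact Or.inl hz
        · exact Or.inr ⟨l, by omega, rfl⟩
    have hWA : ∀ r, ∀ b ∈ A, ∀ l, x b l ∉ W r := by
      rintro r b hb l (hz | ⟨l', -, e⟩)
      · exact hZ b (Finset.mem_insert_of_mem hb) l hz
      · exact haA hb ((hx' _ _ _ _).1 e).1
    have hWa : ∀ (r : ℕ) (l : Fin (s + 1)), r ≤ l → x a l ∉ W r := by
      rintro r l hl (hz | ⟨l', hl', e⟩)
      · exact hZ a (Finset.mem_insert_self _ _) l hz
      · have := ((hx' _ _ _ _).1 e).2
        subst this
        omega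
    have hWmono : ∀ r, W r ⊆ W (r + 1) := by
      rintro r z (hz | ⟨l, hl, rfl⟩)
      exacts [Or.inl hz, Or.inr ⟨l, by omega, rfl⟩]
    have main : ∀ k r : ℕ, r + k = s → ∀ f : MvPolynomial σ K,
        (∀ p ∈ kernelLocus K x (insert a A) (W r), eval p f = 0) →
        f ∈ minorIdeal K x (insert a A) (W r) := by
      intro k
      induction k with
      | zero =>
        intro r hr f hf
        obtain rfl : r = s := hr
        have h1 : f ∈ minorIdeal K x A (W (r + 1)) := by
          refine ih hx (hWA _) ?_
          rintro p ⟨hp, v, hv, hpv⟩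
          refine hf p ⟨fun z hz => hp z (hWmono r hz), v, hv, fun b hb => ?_⟩
          rcases Finset.mem_insert.1 hb with rfl | hb
          · exact Finset.sum_eq_zero fun l _ => by
              rw [hp _ (Or.inr ⟨l, l.is_lt, rfl⟩), zero_mul]
          · exact hpv b hb
        have h2 := hWsucc (Fin.last r)
        rw [Fin.val_last] at h2
        rw [h2] at h1
        obtain ⟨h, hh⟩ := mem_minorIdeal_insert h1
        suffices h3 : h ∈ minorIdeal K (fun b (k : Fin r) => x b k.castSucc) A (W r) by
          have h4 := X_mul_mem_minorIdeal (Z := W r) (Finset.subset_insert a A) (Finset.mem_insert_self a A)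
            (fun k => Or.inr ⟨k.castSucc, k.is_lt, rfl⟩) h3
          simpa using add_mem (minorIdeal_mono (Finset.subset_insert a A) hh) h4
        have hxc : Function.Injective (Function.uncurry fun b (k : Fin r) => x b k.castSucc) := by
          rintro ⟨b, k⟩ ⟨b', k'⟩ e
          obtain ⟨e1, e2⟩ := (hx' _ _ _ _).1 e
          exact Prod.ext e1 (Fin.castSucc_injective _ e2)
        have h5 : ∀ p ∈ kernelLocus K (fun b (k : Fin r) => x b k.castSucc) A (W r),
            eval p f = 0 := by
          rintro p ⟨hp, v, hv, hpv⟩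
          refine hf p ⟨hp, Fin.snoc (α := fun _ => K) v 0, fun h0 => hv ?_, fun b hb => ?_⟩
          · ext k
            simpa using congrFun h0 k.castSucc
          · rw [Fin.sum_univ_castSucc]
            rcases Finset.mem_insert.1 hb with rfl | hb
            · simp only [Fin.snoc_last, mul_zero, add_zero]
              exact Finset.sum_eq_zero fun l _ => by
                rw [hp _ (Or.inr ⟨l.castSucc, l.is_lt, rfl⟩), zero_mul]
            · simpa using hpv b hb
        refine ih hxc (fun b hb k => hWA r b hb _) fun p hp => ?_
        by_cases hne : p (x a (Fin.last r)) = 0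
        swap
        · have := eval_eq_zero_of_mem_minorIdeal (minorIdeal_le_castSucc hh) hp
          simpa [h5 p hp, hne] using this
        refine eval_eq_zero_of_line h p (Pi.single (x a (Fin.last r)) 1) fun t ht => ?_
        have hp' : p + t • Pi.single (x a (Fin.last r)) 1 ∈
            kernelLocus K (fun b (k : Fin r) => x b k.castSucc) A (W r) := by
          obtain ⟨hp, v, hv, hpv⟩ := hp
          refine ⟨fun z hz => ?_, v, hv, fun b hb => ?_⟩
          · have : z ≠ x a (Fin.last r) := fun e => hWa r (Fin.last r) le_rfl (e ▸ hz)
            simp [hp z hz, this]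
          · simpa [Pi.single_apply, hx', haA hb] using hpv b hb
        have := eval_eq_zero_of_mem_minorIdeal (minorIdeal_le_castSucc hh) hp'
        simpa [h5 _ hp', hne, ht] using this
      | succ k ihk =>
        intro r hr f hf
        have hrs : r < s := by omega
        refine mem_of_forall_exists_sub_mul_X_mem (z := x a ⟨r, by omega⟩)
          (P := fun f => ∀ p ∈ kernelLocus K x (insert a A) (W r), eval p f = 0)
          (fun f hf d => homogeneousComponent_mem_minorIdeal hf d) (fun f hf => ?_) hf
        have h1 := ihk (r + 1) (by omega) f fun p ⟨hp, hv⟩ =>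
          hf p ⟨fun z hz => hp z (hWmono r hz), hv⟩
        rw [hWsucc ⟨r, by omega⟩] at h1
        obtain ⟨h, hh⟩ := mem_minorIdeal_insert h1
        refine ⟨h, eval_eq_zero_of_mul_X hx (r := ⟨r, by omega⟩) (l := ⟨r + 1, by omega⟩) (by simp) (fun b hb => ?_)
          (Finset.mem_insert_self a A) (hWa r _ (Nat.le_succ r)) fun p hp => ?_, hh⟩
        · rcases Finset.mem_insert.1 hb with rfl | hb
          · exact hWa r _ le_rfl
          · exact hWA r b hb _
        · have := eval_eq_zero_of_mem_minorIdeal hh hp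
          rwa [map_sub, hf p hp, zero_sub, neg_eq_zero] at this
    have hW0 : W 0 = Z := by simp [hW]
    simpa only [hW0] using main s 0 (zero_add s) f (by rwa [hW0])

theorem minorIdeal_isPrime [Infinite K] {s : ℕ} {x : ρ → Fin (s + 1) → σ}
    (hx : Function.Injective (Function.uncurry x)) {A : Finset ρ} {Z : Set σ}
    (hZ : ∀ a ∈ A, ∀ l, x a l ∉ Z) : (minorIdeal K x A Z).IsPrime := by
  classical
  -- the locus is parametrized by products of an `A × s` and an `s × (s + 1)` matrix
  let g : σ → MvPolynomial (σ ⊕ (ρ × Fin s) ⊕ (Fin s × Fin (s + 1))) K := fun z =>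
    if z ∈ Z then 0 else Function.extend (Function.uncurry x)
      (fun bl => if bl.1 ∈ A then
          ∑ k, X (Sum.inr (Sum.inl (bl.1, k))) * X (Sum.inr (Sum.inr (k, bl.2)))
        else X (Sum.inl (x bl.1 bl.2))) (fun z => X (Sum.inl z)) z
  have hgZ : ∀ z ∈ Z, g z = 0 := fun z hz => if_pos hz
  have hgx : ∀ b l, x b l ∉ Z → g (x b l) = if b ∈ A then
      ∑ k, X (Sum.inr (Sum.inl (b, k))) * X (Sum.inr (Sum.inr (k, l)))
        else X (Sum.inl (x b l)) := fun b l h =>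
    (if_neg h).trans (hx.extend_apply _ _ (b, l))
  have heval : ∀ p f, eval p (bind₁ g f) = eval (fun z => eval p (g z)) f := fun p f =>
    eval₂Hom_bind₁ _ _ _ _
  suffices H : minorIdeal K x A Z = RingHom.ker (bind₁ g).toRingHom by
    rw [H]
    exact RingHom.ker_isPrime _
  ext f
  rw [RingHom.mem_ker]
  constructor
  · intro hf
    refine MvPolynomial.funext fun p => ?_
    rw [map_zero]
    refine (heval p f).trans (eval_eq_zero_of_mem_minorIdeal hf ⟨fun z hz => ?_, ?_⟩)
    · simp [hgZ z hz]
    · let M : Matrix (Fin s) (Fin (s + 1)) K := Matrix.of fun k l => p (Sum.inr (Sum.inr (k, l)))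
      have hker : LinearMap.ker M.mulVecLin ≠ ⊥ := LinearMap.ker_ne_bot_of_finrank_lt (by simp)
      obtain ⟨v, hv, hv0⟩ := Submodule.exists_mem_ne_zero_of_ne_bot hker
      refine ⟨v, hv0, fun b hb => ?_⟩
      have hMv : ∀ k, ∑ l, p (Sum.inr (Sum.inr (k, l))) * v l = 0 := fun k => congrFun hv k
      simp only [hgx b _ (hZ b hb _), if_pos hb, map_sum, map_mul, eval_X, Finset.sum_mul]
      rw [Finset.sum_comm]
      refine Finset.sum_eq_zero fun k _ => ?_
      simp_rw [mul_assoc]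
      rw [← Finset.mul_sum, hMv, mul_zero]
  · intro hf
    refine mem_minorIdeal_of_forall_eval_eq_zero A hx hZ ?_
    rintro p ⟨hp, v, hv, hpv⟩
    let ψ : Module.Dual K (Fin (s + 1) → K) := Fintype.linearCombination K v
    have hψ : ψ ≠ 0 := by
      intro h0
      refine hv (funext fun l => ?_)
      simpa [ψ, Fintype.linearCombination_apply, Pi.single_apply] using
        DFunLike.congr_fun h0 (Pi.single l 1)
    have hrank : Module.finrank K (LinearMap.ker ψ) = s := by
      have := Module.Dual.finrank_ker_add_one_of_ne_zero hψ
      simpa using this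
    let e := Module.finBasisOfFinrankEq K (LinearMap.ker ψ) hrank
    have hrow : ∀ b ∈ A, (fun l => p (x b l)) ∈ LinearMap.ker ψ := fun b hb => by
      simpa [ψ, Fintype.linearCombination_apply] using hpv b hb
    let p' : σ ⊕ (ρ × Fin s) ⊕ (Fin s × Fin (s + 1)) → K := Sum.elim p (Sum.elim
      (fun bk => if hb : bk.1 ∈ A then e.repr ⟨_, hrow bk.1 hb⟩ bk.2 else 0)
      (fun kl => (e kl.1 : Fin (s + 1) → K) kl.2))
    have hp' : (fun z => eval p' (g z)) = p := by
      funext z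
      by_cases hz : z ∈ Z
      · simp [hgZ z hz, hp z hz]
      by_cases hzx : ∃ bl, Function.uncurry x bl = z
      · obtain ⟨⟨b, l⟩, rfl⟩ := hzx
        simp only [Function.uncurry_apply_pair] at hz ⊢
        rw [hgx b l hz]
        split_ifs with hb
        · have h1 : ((∑ k, e.repr ⟨_, hrow b hb⟩ k • e k : LinearMap.ker ψ) : Fin (s + 1) → K) l =
              p (x b l) := by rw [e.sum_repr]
          rw [← h1]
          simp [p', hb, -Module.Basis.sum_repr]
        · simp [p']
      · have h1 : g z = X (Sum.inl z) := (if_neg hz).trans (Function.extend_apply' _ _ _ hzx)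
        simp [h1, p']
    have h2 := heval p' f
    rw [hp'] at h2
    rw [← h2]
    exact (congrArg (eval p') hf).trans (map_zero _)

end MaximalMinors

theorem Lideal_add_Kideal_eq_minorIdeal (n : ℕ) [NeZero n] (i j : ℕ) (hj : j ≤ n) :
    Lideal n i + Kideal n j = minorIdeal ℂ (fun b l => (b, Fin.castLE hj l))
      (Finset.univ.erase (0 : Fin n)) {z | ∃ l : Fin n, (l : ℕ) < i ∧ z = (0, l)} := by
  rw [Submodule.add_eq_sup]
  apply le_antisymm
  · refine sup_le (Ideal.span_le.2 ?_) (Ideal.span_le.2 ?_)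
    · rintro _ ⟨l, hl, rfl⟩
      exact X_mem_minorIdeal ⟨l, hl, rfl⟩
    · rintro _ ⟨_, B, -, hB, rfl⟩
      refine det_mem_minorIdeal (x := fun b l => (b, Fin.castLE hj l)) fun k => ?_
      simpa using fun h => hB k (by rw [h]; rfl)
  · refine minorIdeal_le ?_ fun B hB => ?_
    · rintro _ ⟨l, hl, rfl⟩
      exact Ideal.mem_sup_left (Ideal.subset_span ⟨l, hl, rfl⟩)
    · refine Ideal.mem_sup_right ?_
      by_cases hinj : Function.Injective B
      · have hmem : (Matrix.of fun k l : Fin j =>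
            (X (B (Tuple.sort B k), Fin.castLE hj l) : R n)).det ∈ Kideal n j :=
          Ideal.subset_span ⟨hj, B ∘ Tuple.sort B, (Tuple.monotone_sort B).strictMono_of_injective
            (hinj.comp (Tuple.sort B).injective), fun k h =>
              (Finset.mem_erase.1 (hB (Tuple.sort B k))).1 (Fin.ext h), rfl⟩
        have hperm := Matrix.det_permute (Tuple.sort B)
          (Matrix.of fun k l : Fin j => (X (B k, Fin.castLE hj l) : R n))
        have hmem' := Ideal.mul_mem_left _ ((Equiv.Perm.sign (Tuple.sort B) : ℤ) : R n)
          (hperm ▸ hmem :)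
        rwa [← mul_assoc, ← Int.cast_mul, ← Units.val_mul, Int.units_mul_self, Units.val_one,
          Int.cast_one, one_mul] at hmem'
      · simp only [Function.Injective, not_forall] at hinj
        obtain ⟨k, k', hkk, hne⟩ := hinj
        rw [Matrix.det_zero_of_row_eq hne]
        · exact zero_mem _
        · ext l : 1
          simp [hkk]



/-- Lemma 2.3, first part: for all `0 ≤ i ≤ n-1` and `1 ≤ j ≤ n`,
the ideal `L_i + K_j` is prime. -/
theorem stmt3 (n : ℕ) [NeZero n] (i j : ℕ) (hi : i ≤ n - 1) (hj1 : 1 ≤ j) (hj2 : j ≤ n) :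
    (Lideal n i + Kideal n j).IsPrime := by
  obtain ⟨s, rfl⟩ := Nat.exists_eq_add_of_le' hj1
  rw [Lideal_add_Kideal_eq_minorIdeal n i (s + 1) hj2]
  refine minorIdeal_isPrime ?_ ?_
  · rintro ⟨b, l⟩ ⟨b', l'⟩ h
    simpa [Prod.ext_iff] using h
  · rintro a ha l ⟨l', -, h⟩
    exact (Finset.mem_erase.1 ha).1 (Prod.ext_iff.1 h).1
end
end

section
/- For integers i, j with 0 ≤ i ≤ n−1 and 1 ≤ j ≤ n, there exists an invertible complex n×n matrix g such that every polynomial in the ideal L_i + K_j vanishes under the evaluation z_{kℓ} ↦ g_{kℓ} if and only if i < j. -/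
open MvPolynomial

noncomputable section

/-- If every maximal minor of a tall matrix `A` whose row indices are increasing vanishes, then so
does every minor on an arbitrary family of rows. -/
theorem det_submatrix_eq_zero_of_strictMono {K : Type*} [CommRing K] {n j : ℕ}
    (A : Matrix (Fin n) (Fin j) K)
    (hA : ∀ B : Fin j → Fin n, StrictMono B → (A.submatrix B id).det = 0)
    (f : Fin j → Fin n) : (A.submatrix f id).det = 0 := by
  by_cases hf : Function.Injective f
  · have hmono : StrictMono (f ∘ Tuple.sort f) :=
      (Tuple.monotone_sort f).strictMono_of_injective (hf.comp (Tuple.sort f).injective)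
    have h := hA _ hmono
    have hperm := Matrix.det_permute (Tuple.sort f) (A.submatrix f id)
    rw [Matrix.submatrix_submatrix, Function.id_comp, h] at hperm
    exact ((Units.isUnit (Equiv.Perm.sign (Tuple.sort f))).map
      (Int.castRingHom K)).mul_right_eq_zero.mp hperm.symm
  · simp only [Function.Injective, not_forall] at hf
    obtain ⟨a, b, hab, hne⟩ := hf
    refine Matrix.det_zero_of_row_eq hne ?_
    funext l
    simp [Matrix.submatrix_apply, hab]

/-- If all increasing maximal minors of `A` vanish, then so does `det (H * A)`. -/
theorem det_mul_eq_zero_of_minors {K : Type*} [CommRing K] {n j : ℕ}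
    (H : Matrix (Fin j) (Fin n) K) (A : Matrix (Fin n) (Fin j) K)
    (hA : ∀ B : Fin j → Fin n, StrictMono B → (A.submatrix B id).det = 0) :
    (H * A).det = 0 := by
  have hrow : H * A = fun k => ∑ m, H k m • A m := by
    funext k l
    simp [Matrix.mul_apply, Finset.sum_apply]
  rw [hrow]
  change Matrix.detRowAlternating.toMultilinearMap (fun k => ∑ m, H k m • A m) = 0
  rw [MultilinearMap.map_sum]
  refine Finset.sum_eq_zero fun f _ => ?_
  rw [MultilinearMap.map_smul_univ]
  have h : Matrix.detRowAlternating.toMultilinearMap (fun k => A (f k)) = 0 :=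
    det_submatrix_eq_zero_of_strictMono A hA f
  rw [h, smul_zero]

/-- If all increasing maximal minors of the first `j` columns of `g` vanish, then `g` is singular. -/
theorem not_isUnit_det_of_minors {K : Type*} [CommRing K] [Nontrivial K] {n j : ℕ} (hj : j ≤ n)
    (g : Matrix (Fin n) (Fin n) K)
    (hg : ∀ B : Fin j → Fin n, StrictMono B → (g.submatrix B (Fin.castLE hj)).det = 0) :
    ¬ IsUnit g.det := by
  intro hu
  have h := det_mul_eq_zero_of_minors (g⁻¹.submatrix (Fin.castLE hj) id)
    (g.submatrix id (Fin.castLE hj)) (by simpa using hg)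
  rw [← Matrix.submatrix_mul _ _ _ id _ Function.bijective_id, Matrix.nonsing_inv_mul g hu,
    Matrix.submatrix_one _ (Fin.castLE_injective hj), Matrix.det_one] at h
  exact one_ne_zero h

/-- Evaluating a minor of the generic matrix gives the corresponding minor. -/
theorem eval_generic_minor {n j : ℕ} (g : Matrix (Fin n) (Fin n) ℂ) (B C : Fin j → Fin n) :
    MvPolynomial.eval (fun q : Fin n × Fin n => g q.1 q.2)
      (Matrix.of fun k l : Fin j => (X (B k, C l) : R n)).det = (g.submatrix B C).det := by
  rw [RingHom.map_det]
  congr 1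
  ext k l
  simp

/-- there is an invertible complex `n × n` matrix `g` at which every polynomial
of `L_i + K_j` vanishes (under `z_{kℓ} ↦ g_{kℓ}`) if and only if `i < j`. -/
theorem stmt4 (n : ℕ) [NeZero n] (i j : ℕ) (hi : i ≤ n - 1) (hj1 : 1 ≤ j) (hj2 : j ≤ n) :
    (∃ g : Matrix (Fin n) (Fin n) ℂ, IsUnit g.det ∧
      ∀ p ∈ Lideal n i + Kideal n j,
        MvPolynomial.eval (fun q : Fin n × Fin n => g q.1 q.2) p = 0) ↔ i < j := by
  constructor
  · rintro ⟨g, hg, hp⟩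
    by_contra! hji
    refine not_isUnit_det_of_minors hj2 g (fun B hB => ?_) hg
    by_cases h0 : ∃ k, (B k : ℕ) = 0
    · obtain ⟨k, hk⟩ := h0
      refine Matrix.det_eq_zero_of_row_eq_zero k fun l => ?_
      have hBk : B k = 0 := Fin.ext (by simpa using hk)
      have hmem : (X ((0 : Fin n), Fin.castLE hj2 l) : R n) ∈ Lideal n i :=
        Ideal.subset_span ⟨Fin.castLE hj2 l, by simpa using l.isLt.trans_le hji, rfl⟩
      simpa [hBk] using hp _ (Ideal.mem_sup_left hmem)
    · push Not at h0
      have hmem : (Matrix.of fun k l : Fin j => (X (B k, Fin.castLE hj2 l) : R n)).det ∈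
          Kideal n j := Ideal.subset_span ⟨hj2, B, hB, h0, rfl⟩
      simpa only [eval_generic_minor] using hp _ (Ideal.mem_sup_right hmem)
  · intro hij
    let c : Fin n := ⟨j - 1, by omega⟩
    let σ : Equiv.Perm (Fin n) := Equiv.swap 0 c
    let g : Matrix (Fin n) (Fin n) ℂ := (1 : Matrix (Fin n) (Fin n) ℂ).submatrix σ id
    refine ⟨g, ?_, fun p hp => ?_⟩
    · rw [Matrix.det_permute, Matrix.det_one, mul_one]
      exact (Units.isUnit (Equiv.Perm.sign σ)).map (Int.castRingHom ℂ)
    · have hle : Lideal n i + Kideal n j ≤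
          RingHom.ker (MvPolynomial.eval (fun q : Fin n × Fin n => g q.1 q.2)) := by
        refine sup_le (Ideal.span_le.mpr ?_) (Ideal.span_le.mpr ?_)
        · rintro _ ⟨l, hl, rfl⟩
          have hne : c ≠ l := by
            rintro rfl
            simp only [c] at hl
            omega
          have hσ : σ 0 ≠ l := by rwa [Equiv.swap_apply_left]
          rw [SetLike.mem_coe, RingHom.mem_ker, MvPolynomial.eval_X]
          exact Matrix.one_apply_ne hσ
        · rintro _ ⟨hj, B, -, hB, rfl⟩
          rw [SetLike.mem_coe, RingHom.mem_ker, eval_generic_minor]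
          refine Matrix.det_eq_zero_of_column_eq_zero (⟨j - 1, by omega⟩ : Fin j) fun k => ?_
          have hne : σ (B k) ≠ c := by
            intro h
            have hBk : B k = 0 := σ.injective (h.trans (Equiv.swap_apply_left 0 c).symm)
            exact hB k (by simp [hBk])
          exact Matrix.one_apply_ne hne
      exact hle hp
end
end

section
/- Let i, j, k, ℓ ∈ {1, …, n−1} with i < j and k < ℓ. Then L_i + K_j ⊆ L_k + K_ℓ if and only if i ≤ k and j ≥ ℓ. -/
open MvPolynomial

noncomputable section

/-- The determinant of a submatrix of the generic matrix, evaluated at a point. -/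
theorem eval_minor {n m : ℕ} (z : Fin n × Fin n → ℂ) (B C : Fin m → Fin n) :
    eval z (Matrix.of fun r c : Fin m => (X (B r, C c) : R n)).det =
      (Matrix.of fun r c : Fin m => z (B r, C c)).det := by
  rw [RingHom.map_det]
  congr 1
  ext1 a b
  simp

/-- A point whose first `k` entries in row `0` vanish, and which has a column among the first `l`
that vanishes below row `0`, is a zero of `L_k + K_l`. -/
theorem eval_eq_zero_of_mem {n : ℕ} [NeZero n] {k l : ℕ} (z : Fin n × Fin n → ℂ)
    (hrow : ∀ c : Fin n, (c : ℕ) < k → z (0, c) = 0)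
    (c₀ : Fin n) (hc₀ : (c₀ : ℕ) < l) (hcol : ∀ r : Fin n, (r : ℕ) ≠ 0 → z (r, c₀) = 0)
    {p : R n} (hp : p ∈ Lideal n k + Kideal n l) : eval z p = 0 := by
  have hle : Lideal n k + Kideal n l ≤ RingHom.ker (eval z) := by
    refine sup_le (Ideal.span_le.2 ?_) (Ideal.span_le.2 ?_)
    · rintro p ⟨c, hc, rfl⟩
      simpa [RingHom.mem_ker] using hrow c hc
    · rintro p ⟨hl, B, -, hB0, rfl⟩
      rw [SetLike.mem_coe, RingHom.mem_ker, eval_minor]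
      exact Matrix.det_eq_zero_of_column_eq_zero ⟨c₀, hc₀⟩ fun r => hcol _ (hB0 r)
  exact hle hp

/-- Lemma 2.4(2): for `i, j, k, ℓ ∈ {1,…,n-1}` with `i < j` and `k < ℓ`,
`L_i + K_j ⊆ L_k + K_ℓ` if and only if `i ≤ k` and `j ≥ ℓ`. -/
theorem stmt6 (n : ℕ) [NeZero n] (i j k l : ℕ)
    (hi1 : 1 ≤ i) (hi2 : i ≤ n - 1) (hj1 : 1 ≤ j) (hj2 : j ≤ n - 1)
    (hk1 : 1 ≤ k) (hk2 : k ≤ n - 1) (hl1 : 1 ≤ l) (hl2 : l ≤ n - 1)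
    (hij : i < j) (hkl : k < l) :
    (Lideal n i + Kideal n j ≤ Lideal n k + Kideal n l) ↔ (i ≤ k ∧ l ≤ j) := by
  constructor
  · intro h
    constructor
    · by_contra! hki
      have hkn : k < n := by omega
      have hmem : (X ((0 : Fin n), (⟨k, hkn⟩ : Fin n)) : R n) ∈ Lideal n k + Kideal n l :=
        h (Ideal.mem_sup_left (Ideal.subset_span ⟨⟨k, hkn⟩, hki, rfl⟩))
      have hz := eval_eq_zero_of_mem
        (fun q => if q = ((0 : Fin n), (⟨k, hkn⟩ : Fin n)) then 1 else 0)
        (fun c hc => if_neg fun hq => by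
          have := congrArg (fun q => (q.2 : ℕ)) hq
          simp only at this
          omega)
        ⟨k, hkn⟩ hkl
        (fun r hr => if_neg fun hq => hr (by simpa using congrArg Prod.fst hq)) hmem
      simp at hz
    · by_contra! hjl
      have hjn : j < n := by omega
      let B : Fin j → Fin n := fun r => ⟨r + 1, by omega⟩
      have hmem : (Matrix.of fun r c : Fin j => (X (B r, Fin.castLE hjn.le c) : R n)).det ∈
          Lideal n k + Kideal n l :=
        h (Ideal.mem_sup_right (Ideal.subset_span
          ⟨hjn.le, B, fun a b hab => Nat.succ_lt_succ hab, fun r => Nat.succ_ne_zero _, rfl⟩))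
      have hz := eval_eq_zero_of_mem
        (fun q => if (q.1 : ℕ) = q.2 + 1 ∧ (q.2 : ℕ) < j then 1 else 0)
        (fun c hc => if_neg (by simp)) ⟨j, hjn⟩ hjl (fun r hr => if_neg (by simp)) hmem
      rw [eval_minor] at hz
      have hone : (Matrix.of fun r c : Fin j =>
          if ((B r : Fin n) : ℕ) = (Fin.castLE hjn.le c : Fin n) + 1 ∧
            ((Fin.castLE hjn.le c : Fin n) : ℕ) < j then (1 : ℂ) else 0) = 1 := by
        ext r c
        simp [B, Matrix.one_apply, Fin.ext_iff]
      exact one_ne_zero (Matrix.det_one.symm.trans ((congrArg Matrix.det hone).symm.trans hz))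
  · rintro ⟨hik, hlj⟩
    exact sup_le_sup (Lideal_mono n hik) (Kideal_antitone n hlj)
end
end

section
/- For all i, j ∈ {1, …, n−1}, the product ideal L_i · K_j ⊆ R is a radical ideal, and L_i · K_j = L_i ∩ K_j. -/
open MvPolynomial

noncomputable section

section FractionDegree

open scoped MonomialOrder

variable {σ k : Type*} [Field k]

/-- The degree of the fraction `q`, in the sense of the monomial order `m`, is at most `μ`. -/
def MonomialOrder.FracDegLE (m : MonomialOrder σ) (q : FractionRing (MvPolynomial σ k))
    (μ : σ →₀ ℕ) : Prop :=
  ∃ d a : MvPolynomial σ k, d ≠ 0 ∧ q * algebraMap _ _ d = algebraMap _ _ a ∧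
    m.degree a ≼[m] m.degree d + μ

/-- The fraction `q` has degree less than `μ` in the sense of the monomial order `m`;
this holds for `q = 0` and every `μ`. -/
def MonomialOrder.FracDegLT (m : MonomialOrder σ) (q : FractionRing (MvPolynomial σ k))
    (μ : σ →₀ ℕ) : Prop :=
  ∃ d a : MvPolynomial σ k, d ≠ 0 ∧ q * algebraMap _ _ d = algebraMap _ _ a ∧
    ∀ ν ∈ a.support, ν ≺[m] m.degree d + μ

variable {m : MonomialOrder σ}

lemma MonomialOrder.FracDegLE.of_polynomial {a : MvPolynomial σ k} {μ : σ →₀ ℕ}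
    (h : m.degree a ≼[m] μ) : m.FracDegLE (algebraMap _ (FractionRing (MvPolynomial σ k)) a) μ :=
  ⟨1, a, one_ne_zero, by simp, by
    rw [← C_1, m.degree_C, zero_add]; exact h⟩

lemma MonomialOrder.FracDegLE.mul {p q : FractionRing (MvPolynomial σ k)} {μ ν : σ →₀ ℕ}
    (hp : m.FracDegLE p μ) (hq : m.FracDegLE q ν) : m.FracDegLE (p * q) (μ + ν) := by
  obtain ⟨d, a, hd, hda, ha⟩ := hp
  obtain ⟨e, b, he, heb, hb⟩ := hq
  refine ⟨d * e, a * b, mul_ne_zero hd he, ?_, ?_⟩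
  · rw [map_mul, map_mul, ← hda, ← heb]; ring
  · rw [m.degree_mul hd he]
    refine m.degree_mul_le.trans ?_
    rw [add_add_add_comm, map_add, map_add m.toSyn (_ + _)]
    exact add_le_add ha hb

lemma MonomialOrder.FracDegLE.pow {p : FractionRing (MvPolynomial σ k)} {μ : σ →₀ ℕ}
    (hp : m.FracDegLE p μ) (e : ℕ) : m.FracDegLE (p ^ e) (e • μ) := by
  induction e with
  | zero =>
    rw [pow_zero, ← map_one (algebraMap (MvPolynomial σ k) _)]
    exact .of_polynomial (by rw [← C_1, m.degree_C, zero_smul])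
  | succ e ih => rw [pow_succ, succ_nsmul]; exact ih.mul hp

lemma MonomialOrder.FracDegLE.prod {ι : Type*} (s : Finset ι)
    {p : ι → FractionRing (MvPolynomial σ k)} {μ : ι → σ →₀ ℕ}
    (hp : ∀ i ∈ s, m.FracDegLE (p i) (μ i)) :
    m.FracDegLE (∏ i ∈ s, p i) (∑ i ∈ s, μ i) := by
  classical
  induction s using Finset.induction_on with
  | empty =>
    rw [Finset.prod_empty, ← map_one (algebraMap (MvPolynomial σ k) _)]
    exact .of_polynomial (by rw [← C_1, m.degree_C, Finset.sum_empty])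
  | insert i s hi ih =>
    rw [Finset.prod_insert hi, Finset.sum_insert hi]
    exact (hp i (Finset.mem_insert_self i s)).mul
      (ih fun l hl ↦ hp l (Finset.mem_insert_of_mem hl))

lemma MonomialOrder.FracDegLE.fracDegLT {p : FractionRing (MvPolynomial σ k)} {μ ν : σ →₀ ℕ}
    (hp : m.FracDegLE p μ) (h : μ ≺[m] ν) : m.FracDegLT p ν := by
  obtain ⟨d, a, hd, hda, ha⟩ := hp
  refine ⟨d, a, hd, hda, fun c hc ↦ (m.le_degree hc).trans_lt (ha.trans_lt ?_)⟩
  rw [map_add, map_add]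
  gcongr

lemma MonomialOrder.FracDegLT.zero (μ : σ →₀ ℕ) :
    m.FracDegLT (0 : FractionRing (MvPolynomial σ k)) μ :=
  ⟨1, 0, one_ne_zero, by simp, by simp⟩

lemma MonomialOrder.FracDegLT.add {p q : FractionRing (MvPolynomial σ k)} {μ : σ →₀ ℕ}
    (hp : m.FracDegLT p μ) (hq : m.FracDegLT q μ) : m.FracDegLT (p + q) μ := by
  classical
  obtain ⟨d, a, hd, hda, ha⟩ := hp
  obtain ⟨e, b, he, heb, hb⟩ := hq
  refine ⟨d * e, a * e + b * d, mul_ne_zero hd he, ?_, fun c hc ↦ ?_⟩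
  · rw [map_mul, map_add, map_mul, map_mul, ← hda, ← heb]; ring
  rw [m.degree_mul hd he]
  rcases Finset.mem_union.1 (support_add hc) with h | h
  · obtain ⟨x, hx, y, hy, rfl⟩ := Finset.mem_add.1 (support_mul _ _ h)
    have h1 := ha x hx
    have h2 := m.le_degree hy
    rw [add_right_comm, map_add, map_add m.toSyn (_ + _)]
    exact add_lt_add_of_lt_of_le h1 h2
  · obtain ⟨x, hx, y, hy, rfl⟩ := Finset.mem_add.1 (support_mul _ _ h)
    have h1 := hb x hx
    have h2 := m.le_degree hy
    rw [add_comm (m.degree d), add_right_comm, map_add, map_add m.toSyn (_ + _)]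
    exact add_lt_add_of_lt_of_le h1 h2

lemma MonomialOrder.FracDegLT.sum {ι : Type*} (s : Finset ι)
    {p : ι → FractionRing (MvPolynomial σ k)} {μ : σ →₀ ℕ}
    (hp : ∀ i ∈ s, m.FracDegLT (p i) μ) : m.FracDegLT (∑ i ∈ s, p i) μ :=
  Finset.sum_induction _ (m.FracDegLT · μ) (fun _ _ ↦ .add) (.zero μ) hp

/-- A substitution which does not raise degrees and which fixes the variables of the leading
monomial of `f ≠ 0` does not send `f` to zero. -/
lemma MonomialOrder.aeval_ne_zero_of_fracDegLE {y : σ → FractionRing (MvPolynomial σ k)}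
    (hy : ∀ p, m.FracDegLE (y p) (Finsupp.single p 1)) {f : MvPolynomial σ k} (hf : f ≠ 0)
    (hfix : ∀ p, m.degree f p ≠ 0 → y p = algebraMap _ _ (X p : MvPolynomial σ k)) :
    aeval y f ≠ 0 := by
  classical
  intro h0
  have hmon (μ : σ →₀ ℕ) (c : k) : m.FracDegLE (aeval y (monomial μ c)) μ := by
    have hC : m.FracDegLE
        (algebraMap k (FractionRing (MvPolynomial σ k)) c) 0 := by
      rw [IsScalarTower.algebraMap_apply k (MvPolynomial σ k)]
      exact .of_polynomial (by rw [algebraMap_eq, m.degree_C])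
    have hprod : m.FracDegLE (μ.prod fun p e ↦ y p ^ e) μ := by
      have := FracDegLE.prod (m := m) μ.support (p := fun p ↦ y p ^ μ p)
        (μ := fun p ↦ μ p • Finsupp.single p 1) fun p _ ↦ (hy p).pow _
      have hμ : ∑ p ∈ μ.support, μ p • Finsupp.single p 1 = μ := by
        conv_rhs => rw [← μ.sum_single]
        simp [Finsupp.sum]
      rwa [hμ] at this
    rw [aeval_monomial]
    simpa using hC.mul hprod
  have hlead : aeval y (monomial (m.degree f) (m.leadingCoeff f)) =
      algebraMap _ (FractionRing (MvPolynomial σ k))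
        (monomial (m.degree f) (m.leadingCoeff f)) := by
    rw [aeval_monomial, monomial_eq, map_mul, ← algebraMap_eq,
      ← IsScalarTower.algebraMap_apply, Finsupp.prod, Finsupp.prod, map_prod]
    congr 1
    refine Finset.prod_congr rfl fun p hp ↦ ?_
    rw [hfix p (Finsupp.mem_support_iff.1 hp), map_pow]
  obtain ⟨d, a, hd, hda, ha⟩ : m.FracDegLT
      (∑ μ ∈ f.support.erase (m.degree f), aeval y (monomial μ (f.coeff μ))) (m.degree f) := by
    refine .sum _ fun μ hμ ↦ (hmon μ _).fracDegLT ?_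
    rw [Finset.mem_erase] at hμ
    exact lt_of_le_of_ne (m.le_degree hμ.2) (m.toSyn.injective.ne hμ.1)
  have hsplit : aeval y f = aeval y (monomial (m.degree f) (m.leadingCoeff f)) +
      ∑ μ ∈ f.support.erase (m.degree f), aeval y (monomial μ (f.coeff μ)) := by
    conv_lhs => rw [f.as_sum, map_sum]
    exact (Finset.add_sum_erase _ _ (m.degree_mem_support hf)).symm
  have key : monomial (m.degree f) (m.leadingCoeff f) * d + a = 0 := by
    apply IsFractionRing.injective (MvPolynomial σ k) (FractionRing (MvPolynomial σ k))
    rw [map_add, map_mul, ← hlead, ← hda, ← add_mul, ← hsplit, h0, zero_mul, map_zero]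
  have hcoeff := congrArg (coeff (m.degree f + m.degree d)) key
  have ha0 : coeff (m.degree f + m.degree d) a = 0 := by
    by_contra h
    have := ha _ (mem_support_iff.2 h)
    rw [add_comm (m.degree d)] at this
    exact lt_irrefl _ this
  rw [coeff_add, ha0, add_zero, coeff_monomial_mul, coeff_zero] at hcoeff
  exact mul_ne_zero (m.leadingCoeff_ne_zero_iff.2 hf) (m.leadingCoeff_ne_zero_iff.2 hd) hcoeff

end FractionDegree

section RowLex

open scoped MonomialOrder

/-- The lexicographic monomial order on the entries of a square matrix, with the entries ordered
row by row, the first ones being the largest. -/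
def rowLex (n : ℕ) : MonomialOrder (Fin n × Fin n) where
  syn := Lex (Fin n ×ₗ Fin n →₀ ℕ)
  toSyn := AddEquiv.trans (Finsupp.domCongr (toLex : _ ≃ Fin n ×ₗ Fin n))
    { toEquiv := toLex, map_add' := toLex_add }
  toSyn_monotone _ _ h := Finsupp.toLex_monotone (α := Fin n ×ₗ Fin n) fun _ ↦ h _

lemma rowLex_lt_iff {n : ℕ} {c d : Fin n × Fin n →₀ ℕ} :
    c ≺[rowLex n] d ↔ ∃ p, (∀ q, toLex q < toLex p → c q = d q) ∧ c p < d p := by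
  change toLex (Finsupp.domCongr (toLex : _ ≃ Fin n ×ₗ Fin n) c) <
    toLex (Finsupp.domCongr (toLex : _ ≃ Fin n ×ₗ Fin n) d) ↔ _
  rw [Finsupp.Lex.lt_iff]
  exact Iff.rfl

/-- The exponent of the monomial `∏ i, X (u i, f i)`. -/
def rowColExp {n k : ℕ} (u f : Fin k → Fin n) : Fin n × Fin n →₀ ℕ :=
  ∑ i, Finsupp.single (u i, f i) 1

lemma rowColExp_apply {n k : ℕ} (u f : Fin k → Fin n) (p : Fin n × Fin n) :
    rowColExp u f p = ∑ i, if (u i, f i) = p then 1 else 0 := by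
  simp [rowColExp, Finsupp.finsetSum_apply, Finsupp.single_apply]

lemma rowColExp_comp_lt {n k : ℕ} {u f : Fin k → Fin n} (hu : StrictMono u) (hf : StrictMono f)
    {g : Fin k → Fin k} (hg : Function.Injective g) (hne : g ≠ id) :
    rowColExp u (f ∘ g) ≺[rowLex n] rowColExp u f := by
  obtain ⟨s, hs, hmin⟩ : ∃ s, g s ≠ s ∧ ∀ i < s, g i = i := by
    have : ∃ s, g s ≠ s := by
      by_contra! h
      exact hne (funext h)
    obtain ⟨s, hs, hmin⟩ := WellFounded.has_min wellFounded_lt {s | g s ≠ s} this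
    exact ⟨s, hs, fun i hi ↦ by_contra fun h ↦ hmin i h hi⟩
  have hlt : s < g s := by
    refine lt_of_le_of_ne (le_of_not_gt fun h ↦ hs (hg (hmin _ h))) hs.symm
  rw [rowLex_lt_iff]
  refine ⟨(u s, f s), fun q hq ↦ ?_, ?_⟩
  · rw [rowColExp_apply, rowColExp_apply]
    refine Finset.sum_congr rfl fun i _ ↦ ?_
    rcases lt_or_ge i s with hi | hi
    · rw [Function.comp_apply, hmin i hi]
    obtain ⟨a, b⟩ := q
    rw [Prod.Lex.toLex_lt_toLex] at hq
    have hui := hu.monotone hi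
    rw [if_neg, if_neg]
    · rintro h
      rw [Prod.mk.injEq] at h
      obtain ⟨rfl, rfl⟩ := h
      rcases hq with hq | hq
      · exact absurd hq (not_lt.2 hui)
      · exact absurd hq.2 (not_lt.2 (hf.monotone hi))
    · rintro h
      rw [Prod.mk.injEq] at h
      obtain ⟨rfl, rfl⟩ := h
      rcases hq with hq | hq
      · exact absurd hq (not_lt.2 hui)
      · obtain rfl := hu.injective hq.1
        exact absurd hq.2 (not_lt.2 (hf hlt).le)
  · have h1 : rowColExp u (f ∘ g) (u s, f s) = 0 := by
      rw [rowColExp_apply]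
      refine Finset.sum_eq_zero fun i _ ↦ if_neg fun h ↦ ?_
      rw [Prod.mk.injEq] at h
      obtain rfl := hu.injective h.1
      exact hs (hf.injective h.2)
    have h2 : 0 < rowColExp u f (u s, f s) := by
      rw [rowColExp_apply]
      exact Finset.sum_pos' (fun _ _ ↦ Nat.zero_le _) ⟨s, Finset.mem_univ s, by simp⟩
    omega

variable {n k : ℕ} (u f : Fin k → Fin n)

/-- The minor of the generic matrix with rows `u` and columns `f`. -/
def genMinor : R n := (Matrix.of fun a l : Fin k ↦ (X (u a, f l) : R n)).det

lemma genMinor_eq_sum : genMinor u f =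
    ∑ g : Equiv.Perm (Fin k), monomial (rowColExp u (f ∘ g)) ((g.sign : ℤ) : ℂ) := by
  rw [genMinor, ← Matrix.det_transpose, Matrix.det_apply']
  refine Finset.sum_congr rfl fun g _ ↦ ?_
  have h : ∏ i, (X (u i, f (g i)) : R n) = monomial (rowColExp u (f ∘ g)) 1 := by
    rw [rowColExp, monomial_sum_one]
    rfl
  simp only [Matrix.transpose_apply, Matrix.of_apply]
  rw [h, ← map_intCast (C : ℂ →+* R n), C_mul_monomial, mul_one]

variable {u f}

lemma coeff_genMinor (hu : StrictMono u) (hf : StrictMono f) :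
    (genMinor u f).coeff (rowColExp u f) = 1 := by
  rw [genMinor_eq_sum, coeff_sum, Finset.sum_eq_single 1]
  · simp
  · intro g _ hg
    rw [coeff_monomial, if_neg]
    intro h
    have := rowColExp_comp_lt hu hf g.injective fun h ↦ hg (Equiv.ext fun i ↦ congrFun h i)
    rw [h] at this
    exact lt_irrefl _ this
  · simp

lemma genMinor_ne_zero (hu : StrictMono u) (hf : StrictMono f) : genMinor u f ≠ 0 := fun h ↦ by
  simpa [h] using coeff_genMinor hu hf

lemma degree_genMinor (hu : StrictMono u) (hf : StrictMono f) :
    (rowLex n).degree (genMinor u f) = rowColExp u f := by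
  apply (rowLex n).toSyn.injective
  refine le_antisymm ?_ ?_
  · rw [genMinor_eq_sum]
    refine (rowLex n).degree_sum_le.trans (Finset.sup_le fun g _ ↦ ?_)
    refine ((rowLex n).degree_monomial_le _).trans ?_
    by_cases hg : (g : Fin k → Fin k) = id
    · rw [hg, Function.comp_id]
    · exact (rowColExp_comp_lt hu hf g.injective hg).le
  · exact (rowLex n).le_degree (mem_support_iff.2 (by simp [coeff_genMinor hu hf]))

lemma leadingCoeff_genMinor (hu : StrictMono u) (hf : StrictMono f) :
    (rowLex n).leadingCoeff (genMinor u f) = 1 := by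
  rw [MonomialOrder.leadingCoeff, degree_genMinor hu hf, coeff_genMinor hu hf]

end RowLex

section MaximalMinors

open scoped MonomialOrder

variable {n k : ℕ}

/-- The nonzero row `b` can be inserted at position `s` in the increasing sequence of rows `t`. -/
def FitsAt (t : Fin k → Fin n) (b : Fin n) (s : Fin (k + 1)) : Prop :=
  (b : ℕ) ≠ 0 ∧ StrictMono (Fin.insertNth (α := fun _ ↦ Fin n) s b t)

variable {t : Fin k → Fin n} {b : Fin n} {s s' : Fin (k + 1)}

lemma FitsAt.lt_of_lt (h : FitsAt t b s) {l : Fin k} (hl : l.castSucc < s) : t l < b :=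
  ((Fin.strictMono_insertNth_iff _ _ _).1 h.2).2.1 l hl

lemma FitsAt.lt_of_le (h : FitsAt t b s) {l : Fin k} (hl : s ≤ l.castSucc) : b < t l :=
  ((Fin.strictMono_insertNth_iff _ _ _).1 h.2).2.2 l hl

lemma FitsAt.ne (h : FitsAt t b s) (l : Fin k) : b ≠ t l := by
  rcases lt_or_ge l.castSucc s with hl | hl
  · exact (h.lt_of_lt hl).ne'
  · exact (h.lt_of_le hl).ne

lemma FitsAt.not_lt (h : FitsAt t b s) (h' : FitsAt t b s') : ¬ s < s' := fun hlt ↦ by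
  have hs : s ≠ Fin.last k := (hlt.trans_le (Fin.le_last s')).ne
  obtain ⟨l, rfl⟩ := Fin.exists_castSucc_eq.2 hs
  exact lt_asymm (h'.lt_of_lt hlt) (h.lt_of_le le_rfl)

lemma FitsAt.unique (h : FitsAt t b s) (h' : FitsAt t b s') : s = s' :=
  le_antisymm (le_of_not_gt (h'.not_lt h)) (le_of_not_gt (h.not_lt h'))

lemma exists_fitsAt (ht : StrictMono t) (hb : (b : ℕ) ≠ 0) (hbt : ∀ l, b ≠ t l) :
    ∃ s, FitsAt t b s := by
  obtain ⟨s, hs, hmin⟩ := WellFounded.has_min (wellFounded_lt (α := Fin (k + 1)))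
    {s | ∀ l : Fin k, s ≤ l.castSucc → b < t l}
    ⟨Fin.last k, fun l hl ↦ absurd hl (not_le.2 (Fin.castSucc_lt_last l))⟩
  refine ⟨s, hb, (Fin.strictMono_insertNth_iff _ _ _).2 ⟨ht, fun l hl ↦ ?_, hs⟩⟩
  by_contra h
  refine hmin l.castSucc (fun l' hl' ↦ ?_) hl
  exact (lt_of_le_of_ne (not_lt.1 h) (hbt l)).trans_le
    (ht.monotone (Fin.castSucc_le_castSucc_iff.1 hl'))

/-- A set of entries containing no full diagonal of a maximal minor is avoided by the positions at
which the rows outside some short sequence `t` fit in. -/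
lemma exists_rows_of_no_diagonal (P : Fin n → ℕ → Prop) (j : ℕ)
    (hP : ¬ ∃ B : Fin j → Fin n, StrictMono B ∧ (∀ l, (B l : ℕ) ≠ 0) ∧ ∀ l, P (B l) l) :
    ∃ (k : ℕ) (_ : k + 1 ≤ j) (t : Fin k → Fin n), StrictMono t ∧
      ∀ b s, FitsAt t b s → ¬ P b s := by
  suffices H : ∀ k, (∃ (k' : ℕ) (_ : k' + 1 ≤ k) (t : Fin k' → Fin n), StrictMono t ∧
      ∀ b s, FitsAt t b s → ¬ P b s) ∨
      ∃ t : Fin k → Fin n, StrictMono t ∧ (∀ l, (t l : ℕ) ≠ 0) ∧ (∀ l, P (t l) l) ∧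
        ∀ (l : Fin k) (b : Fin n), (b : ℕ) ≠ 0 → b < t l → (∀ l' < l, t l' < b) → ¬ P b l by
    rcases H j with h | ⟨t, h1, h2, h3, -⟩
    · exact h
    · exact absurd ⟨t, h1, h2, h3⟩ hP
  intro k
  induction k with
  | zero => exact .inr ⟨Fin.elim0, fun l ↦ l.elim0, fun l ↦ l.elim0, fun l ↦ l.elim0,
      fun l ↦ l.elim0⟩
  | succ k ih =>
    rcases ih with ⟨k', hk', t, h⟩ | ⟨t, ht, ht0, htP, hgreedy⟩
    · exact .inl ⟨k', hk'.trans (Nat.le_succ k), t, h⟩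
    by_cases hex : ∃ b : Fin n, (b : ℕ) ≠ 0 ∧ (∀ l, t l < b) ∧ P b k
    · obtain ⟨b, ⟨hb0, hbt, hbP⟩, hmin⟩ := WellFounded.has_min (wellFounded_lt (α := Fin n))
        {b : Fin n | (b : ℕ) ≠ 0 ∧ (∀ l, t l < b) ∧ P b k} hex
      refine .inr ⟨Fin.snoc (α := fun _ ↦ Fin n) t b, ?_, ?_, ?_, ?_⟩
      · intro x y hxy
        induction y using Fin.lastCases with
        | last =>
          obtain ⟨x, rfl⟩ := Fin.exists_castSucc_eq.2 hxy.ne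
          simpa using hbt x
        | cast y =>
          obtain ⟨x, rfl⟩ := Fin.exists_castSucc_eq.2 (hxy.trans (Fin.castSucc_lt_last y)).ne
          simpa using ht (Fin.castSucc_lt_castSucc_iff.1 hxy)
      · intro l
        induction l using Fin.lastCases with
        | last => simpa using hb0
        | cast l => simpa using ht0 l
      · intro l
        induction l using Fin.lastCases with
        | last => simpa using hbP
        | cast l => simpa using htP l
      · intro l c hc0 hcl hcl'
        induction l using Fin.lastCases with
        | last =>
          intro hcP
          rw [Fin.snoc_last] at hcl
          refine hmin c ⟨hc0, fun l ↦ ?_, by simpa using hcP⟩ hcl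
          simpa using hcl' l.castSucc (Fin.castSucc_lt_last l)
        | cast l =>
          rw [Fin.snoc_castSucc] at hcl
          refine hgreedy l c hc0 hcl fun l' hl' ↦ ?_
          simpa using hcl' l'.castSucc (Fin.castSucc_lt_castSucc_iff.2 hl')
    · refine .inl ⟨k, le_rfl, t, ht, fun b s hbs hPb ↦ ?_⟩
      induction s using Fin.lastCases with
      | last => exact hex ⟨b, hbs.1, fun l ↦ hbs.lt_of_lt (Fin.castSucc_lt_last l), by simpa using hPb⟩
      | cast l =>
        exact hgreedy l b hbs.1 (hbs.lt_of_le le_rfl)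
          (fun l' hl' ↦ hbs.lt_of_lt (Fin.castSucc_lt_castSucc_iff.2 hl')) (by simpa using hPb)

variable (t) (hk : k + 1 ≤ n)

/-- The signed maximal minors of the rows `t` of the first `k + 1` columns. -/
def cofactorVec (c : Fin (k + 1)) : R n :=
  (-1) ^ (c : ℕ) * genMinor t (Fin.castLE hk ∘ c.succAbove)

lemma sum_X_mul_cofactorVec (l : Fin k) :
    ∑ c, X (t l, Fin.castLE hk c) * cofactorVec t hk c = 0 := by
  have hdet : (Matrix.of fun a c : Fin (k + 1) ↦
      (X ((Fin.cons (t l) t : Fin (k + 1) → Fin n) a, Fin.castLE hk c) : R n)).det = 0 :=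
    Matrix.det_zero_of_row_eq (Fin.succ_ne_zero l).symm (by ext c; simp)
  rw [Matrix.det_succ_row_zero] at hdet
  rw [← hdet]
  refine Finset.sum_congr rfl fun c _ ↦ ?_
  have : genMinor t (Fin.castLE hk ∘ c.succAbove) = ((Matrix.of fun a c : Fin (k + 1) ↦
      (X ((Fin.cons (t l) t : Fin (k + 1) → Fin n) a, Fin.castLE hk c) : R n)).submatrix
        Fin.succ c.succAbove).det := by
    rw [genMinor]
    congr 1
  rw [cofactorVec, this, Matrix.of_apply, Fin.cons_zero]
  ring

variable {t}

lemma strictMono_castLE_comp_succAbove (c : Fin (k + 1)) :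
    StrictMono (Fin.castLE hk ∘ c.succAbove) :=
  (Fin.strictMono_castLE hk).comp (Fin.strictMono_succAbove c)

lemma cofactorVec_ne_zero (ht : StrictMono t) (c : Fin (k + 1)) : cofactorVec t hk c ≠ 0 :=
  mul_ne_zero (pow_ne_zero _ (neg_ne_zero.2 one_ne_zero))
    (genMinor_ne_zero ht (strictMono_castLE_comp_succAbove hk c))

lemma degree_cofactorVec (ht : StrictMono t) (c : Fin (k + 1)) :
    (rowLex n).degree (cofactorVec t hk c) = rowColExp t (Fin.castLE hk ∘ c.succAbove) := by
  rw [← degree_genMinor ht (strictMono_castLE_comp_succAbove hk c), cofactorVec]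
  rcases neg_one_pow_eq_or (R n) (c : ℕ) with h | h
  · rw [h, one_mul]
  · rw [h, neg_one_mul, MonomialOrder.degree_neg]

lemma degree_X_mul_cofactorVec_le (ht : StrictMono t) (h : FitsAt t b s) (c : Fin (k + 1)) :
    (rowLex n).degree (X (b, Fin.castLE hk c) * cofactorVec t hk c) ≼[rowLex n]
      (rowLex n).degree (cofactorVec t hk s) + Finsupp.single (b, Fin.castLE hk s) 1 := by
  have hexp (c : Fin (k + 1)) :
      Finsupp.single (b, Fin.castLE hk c) 1 + rowColExp t (Fin.castLE hk ∘ c.succAbove) =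
      rowColExp (Fin.insertNth (α := fun _ ↦ Fin n) s b t)
        (Fin.castLE hk ∘ Fin.insertNth (α := fun _ ↦ Fin (k + 1)) s c c.succAbove) := by
    rw [rowColExp, rowColExp, Fin.sum_univ_succAbove _ s]
    simp
  have hid : Fin.insertNth (α := fun _ ↦ Fin (k + 1)) s s s.succAbove = id := by
    funext i
    cases i using Fin.succAboveCases s <;> simp
  have hinj : Function.Injective (Fin.insertNth (α := fun _ ↦ Fin (k + 1)) s c c.succAbove) := by
    intro x y hxy
    cases x using Fin.succAboveCases s <;> cases y using Fin.succAboveCases s <;>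
      simp_all [Fin.succAbove_ne, (Fin.succAbove_ne _ _).symm]
  rw [MonomialOrder.degree_mul (X_ne_zero _) (cofactorVec_ne_zero hk ht c),
    MonomialOrder.degree_X, degree_cofactorVec hk ht, degree_cofactorVec hk ht,
    add_comm (rowColExp _ _), hexp, hexp, hid, Function.comp_id]
  by_cases hg : Fin.insertNth (α := fun _ ↦ Fin (k + 1)) s c c.succAbove = id
  · rw [hg, Function.comp_id]
  · exact (rowColExp_comp_lt h.2 (Fin.strictMono_castLE hk) hinj hg).le

variable (t)

open Classical in
/-- The entries of the matrix obtained from the generic one by changing, in each nonzero row `b`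
outside `t`, the entry in the column at which `b` fits in `t`, so that the nonzero rows become
orthogonal to `cofactorVec t`. -/
def lowRankEntry (p : Fin n × Fin n) : FractionRing (R n) :=
  if h : ∃ s, FitsAt t p.1 s ∧ p.2 = Fin.castLE hk s then
    algebraMap (R n) _ (-∑ c ∈ Finset.univ.erase h.choose,
      X (p.1, Fin.castLE hk c) * cofactorVec t hk c) /
      algebraMap (R n) _ (cofactorVec t hk h.choose)
  else algebraMap (R n) _ (X p)

variable {t}

lemma lowRankEntry_of_fitsAt (h : FitsAt t b s) :
    lowRankEntry t hk (b, Fin.castLE hk s) =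
      algebraMap (R n) _ (-∑ c ∈ Finset.univ.erase s,
        X (b, Fin.castLE hk c) * cofactorVec t hk c) /
        algebraMap (R n) _ (cofactorVec t hk s) := by
  have hex : ∃ s', FitsAt t b s' ∧ Fin.castLE hk s = Fin.castLE hk s' := ⟨s, h, rfl⟩
  have hs : hex.choose = s := hex.choose_spec.1.unique h
  rw [lowRankEntry, dif_pos hex]
  simp only [hs]

lemma lowRankEntry_of_not {p : Fin n × Fin n}
    (h : ¬ ∃ s, FitsAt t p.1 s ∧ p.2 = Fin.castLE hk s) :
    lowRankEntry t hk p = algebraMap (R n) _ (X p) :=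
  dif_neg h

lemma algebraMap_cofactorVec_ne_zero (ht : StrictMono t) (c : Fin (k + 1)) :
    algebraMap (R n) (FractionRing (R n)) (cofactorVec t hk c) ≠ 0 :=
  (map_ne_zero_iff _ (IsFractionRing.injective _ _)).2 (cofactorVec_ne_zero hk ht c)

lemma fracDegLE_lowRankEntry (ht : StrictMono t) (p : Fin n × Fin n) :
    (rowLex n).FracDegLE (lowRankEntry t hk p) (Finsupp.single p 1) := by
  by_cases h : ∃ s, FitsAt t p.1 s ∧ p.2 = Fin.castLE hk s
  · obtain ⟨b, l⟩ := p
    obtain ⟨s, hs, rfl⟩ := h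
    refine ⟨cofactorVec t hk s, -∑ c ∈ Finset.univ.erase s,
      X (b, Fin.castLE hk c) * cofactorVec t hk c, cofactorVec_ne_zero hk ht s, ?_, ?_⟩
    · rw [lowRankEntry_of_fitsAt hk hs,
        div_mul_cancel₀ _ (algebraMap_cofactorVec_ne_zero hk ht s)]
    · rw [MonomialOrder.degree_neg]
      exact (rowLex n).degree_sum_le.trans
        (Finset.sup_le fun c _ ↦ degree_X_mul_cofactorVec_le hk ht hs c)
  · rw [lowRankEntry_of_not hk h]
    exact .of_polynomial (rowLex n).degree_X_le_single

lemma sum_lowRankEntry_mul_cofactorVec (ht : StrictMono t) (hb : (b : ℕ) ≠ 0) :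
    ∑ c, lowRankEntry t hk (b, Fin.castLE hk c) *
      algebraMap (R n) (FractionRing (R n)) (cofactorVec t hk c) = 0 := by
  by_cases hbt : ∃ l, b = t l
  · obtain ⟨l, rfl⟩ := hbt
    have := congrArg (algebraMap (R n) (FractionRing (R n))) (sum_X_mul_cofactorVec t hk l)
    rw [map_sum, map_zero] at this
    rw [← this]
    refine Finset.sum_congr rfl fun c _ ↦ ?_
    rw [lowRankEntry_of_not, map_mul]
    rintro ⟨s, hs, -⟩
    exact hs.ne l rfl
  · obtain ⟨s, hs⟩ := exists_fitsAt ht hb (not_exists.1 hbt)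
    rw [← Finset.add_sum_erase _ _ (Finset.mem_univ s), lowRankEntry_of_fitsAt hk hs,
      div_mul_cancel₀ _ (algebraMap_cofactorVec_ne_zero hk ht s), map_neg, map_sum,
      neg_add_eq_zero]
    refine Finset.sum_congr rfl fun c hc ↦ ?_
    rw [lowRankEntry_of_not, map_mul]
    rintro ⟨s', hs', h⟩
    refine Finset.ne_of_mem_erase hc ?_
    rw [hs.unique hs']
    exact Fin.castLE_injective hk h

lemma aeval_lowRankEntry_genMinor (ht : StrictMono t) {j : ℕ} (hkj : k + 1 ≤ j) (hj : j ≤ n)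
    {B : Fin j → Fin n} (hB : ∀ l, (B l : ℕ) ≠ 0) :
    aeval (lowRankEntry t (hkj.trans hj)) (genMinor B (Fin.castLE hj)) = 0 := by
  rw [genMinor, AlgHom.map_det, ← Matrix.exists_mulVec_eq_zero_iff]
  let v : Fin j → FractionRing (R n) := Function.extend (Fin.castLE hkj)
    (fun c ↦ algebraMap (R n) _ (cofactorVec t (hkj.trans hj) c)) 0
  have hv (c : Fin (k + 1)) : v (Fin.castLE hkj c) =
      algebraMap (R n) _ (cofactorVec t (hkj.trans hj) c) :=
    (Fin.castLE_injective hkj).extend_apply _ _ c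
  refine ⟨v, fun h ↦ ?_, funext fun a ↦ ?_⟩
  · refine algebraMap_cofactorVec_ne_zero (hkj.trans hj) ht 0 ?_
    rw [← hv, h, Pi.zero_apply]
  · rw [Pi.zero_apply, ← sum_lowRankEntry_mul_cofactorVec (hkj.trans hj) ht (hB a)]
    refine (Fintype.sum_of_injective (Fin.castLE hkj) (Fin.castLE_injective hkj) _ _ ?_ ?_).symm
    · intro l hl
      have : v l = 0 := Function.extend_apply' _ _ _ hl
      rw [this, mul_zero]
    · intro c
      rw [hv]
      simp

/-- The ideal of maximal minors `Kideal n j` is radical. -/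
theorem Kideal_isRadical (j : ℕ) : (Kideal n j).IsRadical := by
  intro f hf
  by_cases hj : j ≤ n
  swap
  · have h0 : Kideal n j = ⊥ := by
      rw [Kideal, Ideal.span_eq_bot]
      rintro p ⟨hj', -⟩
      exact absurd hj' hj
    rw [h0] at hf ⊢
    obtain ⟨e, he⟩ := hf
    exact eq_zero_of_pow_eq_zero he
  let S : Set (R n) := {p | ∃ B : Fin j → Fin n, StrictMono B ∧ (∀ l, (B l : ℕ) ≠ 0) ∧
    p = genMinor B (Fin.castLE hj)}
  have hS : S ⊆ Kideal n j := fun p ⟨B, hB, hB0, hp⟩ ↦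
    Ideal.subset_span ⟨hj, B, hB, hB0, hp⟩
  obtain ⟨g, r, hfr, -, hr⟩ := (rowLex n).div_set (B := S) (by
    rintro _ ⟨B, hB, -, rfl⟩
    rw [leadingCoeff_genMinor hB (Fin.strictMono_castLE hj)]
    exact isUnit_one) f
  have hlin : Finsupp.linearCombination _ (fun b : S ↦ (b : R n)) g ∈ Kideal n j := by
    rw [Finsupp.linearCombination_apply]
    exact Submodule.sum_mem _ fun b _ ↦ Ideal.mul_mem_left _ _ (hS b.2)
  suffices r = 0 by
    rw [hfr, this, add_zero]
    exact hlin
  have hrad : r ∈ (Kideal n j).radical := by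
    rw [← add_sub_cancel_left (Finsupp.linearCombination _ (fun b : S ↦ (b : R n)) g) r, ← hfr]
    exact sub_mem hf (Ideal.le_radical hlin)
  by_contra hr0
  obtain ⟨k, hkj, t, ht, htP⟩ := exists_rows_of_no_diagonal
    (fun b l ↦ ∃ h : l < n, (rowLex n).degree r (b, ⟨l, h⟩) ≠ 0) j (by
      rintro ⟨B, hB, hB0, hBP⟩
      refine hr _ ((rowLex n).degree_mem_support hr0) _ ⟨B, hB, hB0, rfl⟩ fun p ↦ ?_
      rw [degree_genMinor hB (Fin.strictMono_castLE hj), rowColExp_apply]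
      by_cases hp : ∃ l, (B l, Fin.castLE hj l) = p
      · obtain ⟨l, rfl⟩ := hp
        rw [Finset.sum_eq_single l]
        · obtain ⟨_, h⟩ := hBP l
          rw [if_pos rfl]
          exact Nat.one_le_iff_ne_zero.2 h
        · intro l' _ hl'
          exact if_neg fun h ↦ hl' (hB.injective (Prod.mk.inj h).1)
        · simp
      · rw [Finset.sum_eq_zero fun l _ ↦ if_neg (not_exists.1 hp l)]
        exact Nat.zero_le _)
  have hker : Kideal n j ≤ RingHom.ker (aeval (lowRankEntry t (hkj.trans hj))) := by
    rw [Kideal, Ideal.span_le]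
    rintro _ ⟨_, B, -, hB0, rfl⟩
    exact aeval_lowRankEntry_genMinor ht hkj hj hB0
  refine MonomialOrder.aeval_ne_zero_of_fracDegLE (m := rowLex n)
    (fracDegLE_lowRankEntry (hkj.trans hj) ht) hr0 ?_ ?_
  · rintro ⟨b, l⟩ hp
    refine lowRankEntry_of_not _ ?_
    rintro ⟨s, hs, rfl⟩
    exact htP b s hs ⟨_, hp⟩
  · obtain ⟨e, he⟩ := hrad
    have := hker he
    rw [RingHom.mem_ker, map_pow] at this
    exact eq_zero_of_pow_eq_zero this

end MaximalMinors

section Product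

variable {n : ℕ} [NeZero n]

/-- The substitution of zero for the generators of `Lideal n i`. -/
def killRow (n : ℕ) [NeZero n] (i : ℕ) : R n →ₐ[ℂ] R n :=
  aeval fun p ↦ if p.1 = 0 ∧ (p.2 : ℕ) < i then 0 else X p

lemma killRow_eq_zero {i : ℕ} {f : R n} (hf : f ∈ Lideal n i) : killRow n i f = 0 := by
  have : Lideal n i ≤ RingHom.ker (killRow n i) := by
    rw [Lideal, Ideal.span_le]
    rintro _ ⟨l, hl, rfl⟩
    simp [killRow, hl]
  exact this hf

lemma sub_killRow_mem (i : ℕ) (f : R n) : f - killRow n i f ∈ Lideal n i := by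
  rw [← Ideal.Quotient.mk_eq_mk_iff_sub_mem]
  have h : (Ideal.Quotient.mkₐ ℂ (Lideal n i)) = (Ideal.Quotient.mkₐ ℂ _).comp (killRow n i) := by
    refine MvPolynomial.algHom_ext fun p ↦ ?_
    obtain ⟨a, l⟩ := p
    rw [AlgHom.comp_apply, killRow, aeval_X]
    split_ifs with hp
    · obtain ⟨rfl, hl⟩ := hp
      rw [map_zero]
      exact Ideal.Quotient.eq_zero_iff_mem.2 (Ideal.subset_span ⟨l, hl, rfl⟩)
    · rfl
  exact DFunLike.congr_fun h f

lemma Lideal_isRadical (i : ℕ) : (Lideal n i).IsRadical := by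
  rintro f ⟨e, he⟩
  have := killRow_eq_zero he
  rw [map_pow] at this
  simpa [eq_zero_of_pow_eq_zero this] using sub_killRow_mem i f

lemma killRow_minor (i : ℕ) {j : ℕ} (hj : j ≤ n) {B : Fin j → Fin n} (hB : ∀ l, (B l : ℕ) ≠ 0) :
    killRow n i (genMinor B (Fin.castLE hj)) = genMinor B (Fin.castLE hj) := by
  rw [genMinor, AlgHom.map_det]
  congr 1
  ext1 a l
  have : B a ≠ 0 := fun h ↦ hB a (by simp [h])
  simp [killRow, this]

lemma sub_killRow_mem_mul (i : ℕ) {j : ℕ} {f : R n} (hf : f ∈ Kideal n j) :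
    f - killRow n i f ∈ Lideal n i * Kideal n j := by
  induction hf using Submodule.span_induction with
  | mem p hp =>
    obtain ⟨hj, B, -, hB, rfl⟩ := hp
    have := killRow_minor i hj hB
    rw [genMinor] at this
    rw [this, sub_self]
    exact zero_mem _
  | zero => simp
  | add x y _ _ hx hy => rw [map_add, add_sub_add_comm]; exact add_mem hx hy
  | smul a x hx ih =>
    rw [smul_eq_mul, map_mul, show a * x - killRow n i a * killRow n i x =
      (a - killRow n i a) * x + killRow n i a * (x - killRow n i x) by ring]
    exact add_mem (Ideal.mul_mem_mul (sub_killRow_mem i a) hx) (Ideal.mul_mem_left _ _ ih)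

lemma Lideal_mul_Kideal (i j : ℕ) : Lideal n i * Kideal n j = Lideal n i ⊓ Kideal n j := by
  refine le_antisymm Ideal.mul_le_inf fun f hf ↦ ?_
  simpa [killRow_eq_zero hf.1] using sub_killRow_mem_mul i hf.2

end Product

/-- Lemma 2.5: for `i, j ∈ {1,…,n-1}`, the product ideal `L_i · K_j` is
radical, and `L_i · K_j = L_i ∩ K_j`. -/
theorem stmt7 (n : ℕ) [NeZero n] (i j : ℕ)
    (hi1 : 1 ≤ i) (hi2 : i ≤ n - 1) (hj1 : 1 ≤ j) (hj2 : j ≤ n - 1) :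
    (Lideal n i * Kideal n j).radical = Lideal n i * Kideal n j ∧
    Lideal n i * Kideal n j = Lideal n i ⊓ Kideal n j := by
  refine ⟨?_, Lideal_mul_Kideal i j⟩
  rw [Lideal_mul_Kideal]
  exact ((Lideal_isRadical i).inf (Kideal_isRadical j)).radical
end
end
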